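/- arXiv:1011.3770 — 3 statements merged into one kernel-verified Lean document; each statement's English description precedes it below -/
import Mathlib

section
/- There exist constants c0 > 0 and C0 > 0 such that for every ε > 0 and every sufficiently large n, there is a metric space (V,c) on n points with a root r ∈ V with the following property: for every probability distribution D over collections P = {p_v : v ∈ V} of vertex-to-root paths, there exists a terminal set X ⊆ V with |X| ≤ C0·log n such that Pr_{P←D}[ c(P[X]) ≤ c0·(log n/(1+ε))·opt_ST(X) ] ≤ (1/2)·exp(−ε·|X|). -/
open scoped Classical

noncomputable section

/-- A finitely supported probability distribution on a type `A`. -/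
structure FinDist (A : Type*) where
  w : A →₀ ℝ
  nonneg : ∀ a, 0 ≤ w a
  total : ∑ a ∈ w.support, w a = 1

namespace FinDist

variable {A : Type*}

/-- The (finite) support of a finitely supported distribution. -/
def support (D : FinDist A) : Finset A := D.w.support

/-- The probability of an event under a finitely supported distribution. -/
def pr (D : FinDist A) (p : A → Prop) : ℝ :=
  ∑ a ∈ D.support.filter p, D.w a

/-- The expectation of a real-valued function under a finitely supported distribution. -/
def exp (D : FinDist A) (f : A → ℝ) : ℝ :=
  ∑ a ∈ D.support, D.w a * f a

end FinDist

/-- `c` is a metric on `V`. -/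
structure IsMetric {V : Type*} (c : V → V → ℝ) : Prop where
  refl : ∀ x, c x x = 0
  pos : ∀ x y, x ≠ y → 0 < c x y
  symm : ∀ x y, c x y = c y x
  triangle : ∀ x y z, c x z ≤ c x y + c y z

/-- The cost of an unordered pair of vertices (agrees with `c` when `c` is symmetric). -/
def sym2Cost {V : Type*} (c : V → V → ℝ) : Sym2 V → ℝ :=
  Sym2.lift ⟨fun x y => (c x y + c y x) / 2, fun x y => by dsimp; ring⟩

/-- A path (sequence of distinct vertices) from `v` to `r`. -/
def RootPath (V : Type*) (v r : V) : Type _ :=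
  {l : List V // l.Nodup ∧ l.head? = some v ∧ l.getLast? = some r}

/-- A collection of vertex-to-root paths, one for each vertex. -/
def PathSystem (V : Type*) (r : V) : Type _ := ∀ v : V, RootPath V v r

/-- The set of (unordered) edges of a list of vertices: pairs of consecutive entries. -/
def listEdges {V : Type*} [DecidableEq V] (l : List V) : Finset (Sym2 V) :=
  ((l.zip l.tail).map (fun p => s(p.1, p.2))).toFinset

/-- `c(P[X])`: the total cost of the union of the edges of the paths `p_v`, `v ∈ X`. -/
def pathSystemCost {V : Type*} [DecidableEq V] (c : V → V → ℝ) {r : V}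
    (P : PathSystem V r) (X : Finset V) : ℝ :=
  ∑ e ∈ X.biUnion (fun v => listEdges (P v).1), sym2Cost c e

/-- The set of costs of Steiner trees for `X ∪ {r}`: trees `T` on vertex sets `W`
with `X ∪ {r} ⊆ W ⊆ V`. -/
def steinerCosts {V : Type*} [Fintype V] [DecidableEq V] (c : V → V → ℝ) (r : V)
    (X : Finset V) : Set ℝ :=
  {y | ∃ (W : Finset V) (T : SimpleGraph V),
    insert r X ⊆ W ∧
    (∀ e ∈ T.edgeSet, ∀ v ∈ e, v ∈ W) ∧
    (SimpleGraph.induce (↑W) T).IsTree ∧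
    y = ∑ e ∈ Finset.univ.filter (fun e : Sym2 V => e ∈ T.edgeSet), sym2Cost c e}

/-- `opt_ST(X)`: the optimal Steiner tree cost for `X ∪ {r}`. -/
def optST {V : Type*} [Fintype V] [DecidableEq V] (c : V → V → ℝ) (r : V)
    (X : Finset V) : ℝ :=
  sInf (steinerCosts c r X)

/-- The cost of the closed tour that starts at `r`, visits the vertices of `l` in order,
and returns to `r`. -/
def tourCost {V : Type*} (c : V → V → ℝ) (r : V) (l : List V) : ℝ :=
  ((((r :: l) ++ [r]).zip (((r :: l) ++ [r]).tail)).map (fun p => c p.1 p.2)).sum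

/-- `σ_X`: the ordering that the tour `σ` induces on the elements of `X`. -/
def permInduced {n : ℕ} (σ : Equiv.Perm (Fin n)) (X : Finset (Fin n)) : List (Fin n) :=
  ((List.finRange n).map σ).filter (fun v => decide (v ∈ X))

/-- `opt_TSP(X)`: the minimum closed-tour cost through `X ∪ {r}`. -/
def optTSP {V : Type*} [DecidableEq V] (c : V → V → ℝ) (r : V) (X : Finset V) : ℝ :=
  sInf {y | ∃ l : List V, l.Nodup ∧ l.toFinset = X ∧ y = tourCost c r l}

/-- An `(n,d,β)`-expander: a `d`-regular graph on `n` vertices such that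
`|xᵀAx| ≤ β·d·xᵀx` for every `x` orthogonal to the all-ones vector. -/
def IsExpander (n d : ℕ) (β : ℝ) (G : SimpleGraph (Fin n)) : Prop :=
  (∀ v : Fin n, (Finset.univ.filter (fun w => G.Adj v w)).card = d) ∧
  ∀ x : Fin n → ℝ, (∑ v, x v = 0) →
    |∑ v, ∑ w, (if G.Adj v w then x v * x w else 0)| ≤ β * d * ∑ v, (x v) ^ 2

/-- `u : Fin (t+1) → Fin n` encodes a `t`-step walk in `G`. -/
def IsWalkFun {n : ℕ} (G : SimpleGraph (Fin n)) {t : ℕ} (u : Fin (t + 1) → Fin n) : Prop :=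
  ∀ i : Fin t, G.Adj (u i.castSucc) (u i.succ)

/-- The probability that a `t`-step random walk on a `d`-regular graph `G`
(uniform start, uniform steps; each walk has probability `1/(n·dᵗ)`) satisfies `p`. -/
def walkPr {n : ℕ} (G : SimpleGraph (Fin n)) (d t : ℕ)
    (p : (Fin (t + 1) → Fin n) → Prop) : ℝ :=
  ((Finset.univ.filter
      (fun u : Fin (t + 1) → Fin n => IsWalkFun G u ∧ p u)).card : ℝ) / (n * d ^ t)

/-- The probability that two independent `t`-step random walks on `G` satisfy `p`. -/
def walkPairPr {n : ℕ} (G : SimpleGraph (Fin n)) (d t : ℕ)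
    (p : (Fin (t + 1) → Fin n) → (Fin (t + 1) → Fin n) → Prop) : ℝ :=
  ((Finset.univ.filter
      (fun q : (Fin (t + 1) → Fin n) × (Fin (t + 1) → Fin n) =>
        IsWalkFun G q.1 ∧ IsWalkFun G q.2 ∧ p q.1 q.2)).card : ℝ) / (n * d ^ t) ^ 2

/-- The edge set of the path from `u` to `v` in `T` (the unique such path when `T`
is a tree); empty if `u` and `v` are not connected in `T`. -/
def treePathEdges {V : Type*} [DecidableEq V] (T : SimpleGraph V) (u v : V) :
    Finset (Sym2 V) :=
  if h : T.Reachable u v then (h.some.toPath : T.Path u v).1.edges.toFinset else ∅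

/-- `c_T(u,v)`: the cost of the unique `u`–`v` path in the tree `T`. -/
def treePathCost {V : Type*} [DecidableEq V] (c : V → V → ℝ) (T : SimpleGraph V)
    (u v : V) : ℝ :=
  ∑ e ∈ treePathEdges T u v, sym2Cost c e

/-- `c(T[X])`: the cost of the minimal subtree of the tree `T` containing `X ∪ {r}`. -/
def subtreeCost {V : Type*} [DecidableEq V] (c : V → V → ℝ) (T : SimpleGraph V)
    (r : V) (X : Finset V) : ℝ :=
  ∑ e ∈ (insert r X).biUnion (fun v => treePathEdges T v r), sym2Cost c e

end

namespace UniversalSteiner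

open SimpleGraph Finset

section Graph

variable {V : Type*}

/-- Every cycle of `G` is longer than `g`. -/
def NoShortCycle (G : SimpleGraph V) (g : ℕ) : Prop :=
  ∀ (v : V) (p : G.Walk v v), p.IsCycle → g < p.length

/-- Paths of length at most `k` are determined by their endpoints. -/
def UniqueShortPaths (G : SimpleGraph V) (k : ℕ) : Prop :=
  ∀ (u v : V) (p q : G.Walk u v), p.IsPath → q.IsPath → p.length ≤ k → q.length ≤ k → p = q

theorem NoShortCycle.uniqueShortPaths {G : SimpleGraph V} {k : ℕ}
    (hG : NoShortCycle G (2 * k)) : UniqueShortPaths G k := by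
  intro u v p q hp hq hpk hqk
  let s : Finset (Sym2 V) := p.edges.toFinset ∪ q.edges.toFinset
  have hsG : ∀ e ∈ s, e ∈ G.edgeSet := by
    intro e he
    rcases Finset.mem_union.mp he with he | he
    · exact p.edges_subset_edgeSet (List.mem_toFinset.mp he)
    · exact q.edges_subset_edgeSet (List.mem_toFinset.mp he)
  have hsub : ∀ e ∈ s, e ∈ (fromEdgeSet (s : Set (Sym2 V))).edgeSet := by
    intro e he
    rw [edgeSet_fromEdgeSet]
    exact ⟨he, fun hd => G.not_isDiag_of_mem_edgeSet (hsG e he) hd⟩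
  have hH : (fromEdgeSet (s : Set (Sym2 V))).IsAcyclic := by
    intro w c hc
    have hcs : ∀ e ∈ c.edges, e ∈ s := by
      intro e he
      have := c.edges_subset_edgeSet he
      rw [edgeSet_fromEdgeSet] at this
      exact this.1
    have h1 := hG w (c.transfer G fun e he => hsG e (hcs e he)) (hc.transfer _)
    rw [Walk.length_transfer, ← Walk.length_edges] at h1
    have h2 : c.edges.length ≤ s.card := by
      rw [← List.toFinset_card_of_nodup hc.edges_nodup]
      exact Finset.card_le_card fun e he => hcs e (List.mem_toFinset.mp he)
    have h3 : s.card ≤ p.length + q.length := by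
      refine (Finset.card_union_le _ _).trans (add_le_add ?_ ?_)
      · exact (List.toFinset_card_le _).trans p.length_edges.le
      · exact (List.toFinset_card_le _).trans q.length_edges.le
    omega
  have hps : ∀ e ∈ p.edges, e ∈ (fromEdgeSet (s : Set (Sym2 V))).edgeSet := fun e he =>
    hsub e (Finset.mem_union_left _ (List.mem_toFinset.mpr he))
  have hqs : ∀ e ∈ q.edges, e ∈ (fromEdgeSet (s : Set (Sym2 V))).edgeSet := fun e he =>
    hsub e (Finset.mem_union_right _ (List.mem_toFinset.mpr he))
  have heq := congrArg Subtype.val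
    ((hH.subsingleton_path u v).elim ⟨p.transfer _ hps, hp.transfer hps⟩
      ⟨q.transfer _ hqs, hq.transfer hqs⟩)
  have := congrArg Walk.support heq
  simp only [Walk.support_transfer] at this
  exact Walk.ext_support this

/-- Two short paths leaving a vertex in different directions form a path. -/
theorem UniqueShortPaths.isPath_reverse_append {G : SimpleGraph V} {k : ℕ}
    (hG : UniqueShortPaths G k) {v x y : V} {p : G.Walk v x} {q : G.Walk v y}
    (hp : p.IsPath) (hq : q.IsPath) (hpk : p.length ≤ k) (hqk : q.length ≤ k)
    (hne : ¬ p.Nil → ¬ q.Nil → p.snd ≠ q.snd) : (p.reverse.append q).IsPath := by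
  rw [Walk.isPath_def, Walk.support_append, List.nodup_append]
  refine ⟨by simpa using hp.support_nodup, hq.support_nodup.tail, ?_⟩
  rintro a ha b hb rfl
  rw [Walk.support_reverse, List.mem_reverse] at ha
  have hav : a ≠ v := by
    rintro rfl
    have := hq.support_nodup
    rw [← Walk.cons_tail_support] at this
    exact (List.nodup_cons.mp this).1 hb
  have hb' : a ∈ q.support := List.mem_of_mem_tail hb
  have heq := hG v a _ _ (hp.takeUntil ha) (hq.takeUntil hb')
    ((p.length_takeUntil_le_length ha).trans hpk) ((q.length_takeUntil_le_length hb').trans hqk)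
  refine hne ?_ ?_ ?_
  · intro hnil
    rw [Walk.nil_iff_support_eq.mp hnil] at ha
    exact hav (by simpa using ha)
  · intro hnil
    rw [Walk.nil_iff_support_eq.mp hnil] at hb'
    exact hav (by simpa using hb')
  · rw [← Walk.snd_takeUntil hav p ha, ← Walk.snd_takeUntil hav q hb', heq]

theorem exists_append_cons_of_mem_edges {G : SimpleGraph V} {u v : V} (p : G.Walk u v)
    {e : Sym2 V} (he : e ∈ p.edges) :
    ∃ (x y : V) (h : G.Adj x y) (p₁ : G.Walk u x) (p₂ : G.Walk y v),
      s(x, y) = e ∧ p = p₁.append (Walk.cons h p₂) := by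
  induction p with
  | nil => simp at he
  | @cons a b c h p ih =>
    rw [Walk.edges_cons, List.mem_cons] at he
    rcases he with rfl | he
    · exact ⟨a, b, h, Walk.nil, p, rfl, rfl⟩
    · obtain ⟨x, y, h', p₁, p₂, hxy, rfl⟩ := ih he
      exact ⟨x, y, h', Walk.cons h p₁, p₂, hxy, rfl⟩

/-- Joining two vertices that are far apart creates no short cycle. -/
theorem NoShortCycle.sup_edge {G : SimpleGraph V} {g : ℕ} (hG : NoShortCycle G g) {x y : V}
    (hfar : ∀ p : G.Walk x y, g < p.length) : NoShortCycle (G ⊔ edge x y) g := by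
  intro v c hc
  by_contra! hlen
  have hmem : ∀ e ∈ (G ⊔ edge x y).edgeSet, e ≠ s(x, y) → e ∈ G.edgeSet := by
    intro e he hne
    induction e with
    | _ a b =>
      rw [mem_edgeSet, sup_adj, edge_adj] at he
      rcases he with he | ⟨h1, -⟩
      · exact he
      · exact absurd (by grind) hne
  by_cases he : s(x, y) ∈ c.edges
  · obtain ⟨a, b, h, p₁, p₂, hab, rfl⟩ := exists_append_cons_of_mem_edges c he
    have hnd := hc.edges_nodup
    rw [Walk.edges_append, Walk.edges_cons, List.nodup_append] at hnd
    have hav : ∀ e ∈ (p₂.append p₁).edges, e ∈ G.edgeSet := by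
      intro e hep
      refine hmem e (Walk.edges_subset_edgeSet _ hep) ?_
      rintro rfl
      rw [Walk.edges_append, List.mem_append] at hep
      rcases hep with hep | hep
      · exact (List.nodup_cons.mp hnd.2.1).1 (hab ▸ hep)
      · exact hnd.2.2 _ hep s(a, b) (by simp) hab.symm
    have hl : ((p₂.append p₁).transfer G hav).length < g := by
      rw [Walk.length_transfer, Walk.length_append]
      rw [Walk.length_append, Walk.length_cons] at hlen
      omega
    rcases Sym2.eq_iff.mp hab with ⟨rfl, rfl⟩ | ⟨rfl, rfl⟩
    · have := hfar ((p₂.append p₁).transfer G hav).reverse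
      rw [Walk.length_reverse] at this
      omega
    · have := hfar ((p₂.append p₁).transfer G hav)
      omega
  · have hav : ∀ e ∈ c.edges, e ∈ G.edgeSet := fun e hec =>
      hmem e (c.edges_subset_edgeSet hec) (fun h => he (h ▸ hec))
    have := hG v (c.transfer G hav) (hc.transfer hav)
    rw [Walk.length_transfer] at this
    omega

/-- The walk following the values of a function on an interval of natural numbers. -/
theorem exists_walk_getVert {G : SimpleGraph V} (f : ℕ → V) (k : ℕ) :
    ∀ i : ℕ, (∀ m, i ≤ m → m < i + k → G.Adj (f m) (f (m + 1))) →
    ∃ p : G.Walk (f i) (f (i + k)), p.length = k ∧ ∀ m ≤ k, p.getVert m = f (i + m) := by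
  induction k with
  | zero =>
    intro i _
    exact ⟨Walk.nil, rfl, fun m hm => by simp [Nat.le_zero.mp hm]⟩
  | succ k ih =>
    intro i h
    obtain ⟨p, hp, hv⟩ := ih (i + 1) fun m h1 h2 => h m (by omega) (by omega)
    have hend : i + 1 + k = i + (k + 1) := by omega
    refine ⟨(Walk.cons (h i le_rfl (by omega)) p).copy rfl (by rw [hend]), by simp [hp], ?_⟩
    intro m hm
    rw [Walk.getVert_copy]
    cases m with
    | zero => simp
    | succ m =>
      rw [Walk.getVert_cons_succ, hv m (by omega)]
      congr 1
      omega

theorem exists_path_getVert {G : SimpleGraph V} (f : ℕ → V) {i j : ℕ} (hij : i ≤ j)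
    (hadj : ∀ m, i ≤ m → m < j → G.Adj (f m) (f (m + 1)))
    (hinj : Set.InjOn f (Set.Icc i j)) :
    ∃ p : G.Walk (f i) (f j), p.IsPath ∧ p.length = j - i ∧
      ∀ m ≤ j - i, p.getVert m = f (i + m) := by
  obtain ⟨k, rfl⟩ := Nat.exists_eq_add_of_le hij
  obtain ⟨p, hp, hv⟩ := exists_walk_getVert f k i hadj
  rw [Nat.add_sub_cancel_left]
  refine ⟨p, ?_, hp, hv⟩
  rw [← Walk.IsPath.getVert_injOn_iff]
  intro a ha b hb hab
  simp only [Set.mem_ofPred_eq, hp] at ha hb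
  rw [hv a ha, hv b hb] at hab
  have := hinj ⟨by omega, by omega⟩ ⟨by omega, by omega⟩ hab
  omega

/-- `u` lists the vertices of a path with `k` edges. -/
structure IsPathFun (G : SimpleGraph V) {k : ℕ} (u : Fin (k + 1) → V) : Prop where
  adj : ∀ i : Fin k, G.Adj (u i.castSucc) (u i.succ)
  injective : Function.Injective u

theorem IsPathFun.exists_path {G : SimpleGraph V} {k : ℕ} {u : Fin (k + 1) → V}
    (hu : IsPathFun G u) {i j : Fin (k + 1)} (hij : i ≤ j) :
    ∃ p : G.Walk (u i) (u j), p.IsPath ∧ p.length = j - i ∧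
      ∀ m : Fin (k + 1), i ≤ m → m ≤ j → p.getVert (m - i) = u m := by
  let f : ℕ → V := fun m => u ⟨min m k, by omega⟩
  have hf : ∀ m : Fin (k + 1), f m = u m := fun m => by
    simp only [f]
    congr 1
    ext
    exact min_eq_left (by omega)
  obtain ⟨p, hp, hl, hv⟩ := exists_path_getVert (G := G) f (i := i) (j := j) hij
    (fun m h1 h2 => by
      have := hu.adj ⟨m, by omega⟩
      rwa [← hf, ← hf] at this)
    (fun a ha b hb hab => by
      have := congrArg Fin.val (hu.injective hab)
      have ha := ha.2
      have hb := hb.2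
      simp only [] at this
      omega)
  refine ⟨p.copy (hf i) (hf j), by simpa using hp, by simpa using hl, fun m h1 h2 => ?_⟩
  rw [Walk.getVert_copy, hv _ (by omega), ← hf]
  congr 1
  omega

theorem IsPathFun.snoc {G : SimpleGraph V} {k : ℕ} {u : Fin (k + 1) → V} (hu : IsPathFun G u)
    {w : V} (hadj : G.Adj (u (Fin.last k)) w) (hw : ∀ i, u i ≠ w) :
    IsPathFun G (Fin.snoc u w : Fin (k + 1 + 1) → V) := by
  refine ⟨fun i => ?_, ?_⟩
  · refine Fin.lastCases ?_ (fun i => ?_) i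
    · rw [Fin.succ_last, Fin.snoc_castSucc (α := fun _ => V), Fin.snoc_last (α := fun _ => V)]
      exact hadj
    · rw [Fin.succ_castSucc, Fin.snoc_castSucc (α := fun _ => V),
        Fin.snoc_castSucc (α := fun _ => V)]
      exact hu.adj i
  · intro a b
    refine Fin.lastCases ?_ (fun a => ?_) a <;> refine Fin.lastCases ?_ (fun b => ?_) b
    · exact fun _ => rfl
    · intro h
      rw [Fin.snoc_castSucc (α := fun _ => V), Fin.snoc_last (α := fun _ => V)] at h
      exact absurd h.symm (hw b)
    · intro h
      rw [Fin.snoc_castSucc (α := fun _ => V), Fin.snoc_last (α := fun _ => V)] at h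
      exact absurd h (hw a)
    · intro h
      rw [Fin.snoc_castSucc (α := fun _ => V), Fin.snoc_castSucc (α := fun _ => V)] at h
      rw [hu.injective h]

end Graph


section Counting

variable {V : Type*} [Fintype V]

/-- The neighbours of a vertex, as a finset. -/
noncomputable def nbrs (G : SimpleGraph V) (v : V) : Finset V := univ.filter (G.Adj v)

theorem mem_nbrs {G : SimpleGraph V} {v w : V} : w ∈ nbrs G v ↔ G.Adj v w := by
  simp [nbrs]

/-- The vertices at distance at most `k` from the set `S`. -/
noncomputable def ball (G : SimpleGraph V) (S : Finset V) : ℕ → Finset V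
  | 0 => S
  | k + 1 => (ball G S k).biUnion fun y => insert y (nbrs G y)

theorem ball_subset_succ (G : SimpleGraph V) (S : Finset V) (k : ℕ) :
    ball G S k ⊆ ball G S (k + 1) := fun x hx =>
  Finset.mem_biUnion.mpr ⟨x, hx, Finset.mem_insert_self _ _⟩

theorem ball_mono (G : SimpleGraph V) (S : Finset V) : Monotone (ball G S) :=
  monotone_nat_of_le_succ (ball_subset_succ G S)

theorem mem_ball_succ_of_adj {G : SimpleGraph V} {S : Finset V} {k : ℕ} {x y : V}
    (hx : x ∈ ball G S k) (h : G.Adj x y) : y ∈ ball G S (k + 1) :=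
  Finset.mem_biUnion.mpr ⟨x, hx, Finset.mem_insert_of_mem (mem_nbrs.mpr h)⟩

theorem card_ball_le {G : SimpleGraph V} {d : ℕ} (hd : ∀ v, (nbrs G v).card ≤ d)
    (S : Finset V) (k : ℕ) : (ball G S k).card ≤ S.card * (d + 1) ^ k := by
  induction k with
  | zero => simp [ball]
  | succ k ih =>
    calc (ball G S (k + 1)).card ≤ (ball G S k).card * (d + 1) :=
          Finset.card_biUnion_le_card_mul _ _ _ fun y _ =>
            (Finset.card_insert_le _ _).trans (Nat.succ_le_succ (hd y))
      _ ≤ S.card * (d + 1) ^ k * (d + 1) := Nat.mul_le_mul_right _ ih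
      _ = S.card * (d + 1) ^ (k + 1) := by ring

theorem mem_ball_add_length {G : SimpleGraph V} {S : Finset V} {x y : V} (p : G.Walk x y) :
    ∀ k : ℕ, x ∈ ball G S k → y ∈ ball G S (k + p.length) := by
  induction p with
  | nil => exact fun k hk => hk
  | cons h p ih =>
    intro k hk
    have := ih (k + 1) (mem_ball_succ_of_adj hk h)
    rwa [Walk.length_cons, show k + (p.length + 1) = k + 1 + p.length by omega]

/-- Erdős–Sachs: an edge-maximal graph among those with maximum degree at most `d` and without
cycles of length at most `g` is `d`-regular outside a small set of vertices. -/
theorem exists_almost_regular_noShortCycle (V : Type*) [Fintype V] (d : ℕ) {g : ℕ}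
    (hg : 0 < g) :
    ∃ G : SimpleGraph V, NoShortCycle G g ∧ (∀ v, (nbrs G v).card ≤ d) ∧
      (univ.filter fun v => (nbrs G v).card < d).card ≤ (d + 1) ^ g := by
  have hne : {G : SimpleGraph V | NoShortCycle G g ∧ ∀ v, (nbrs G v).card ≤ d}.Nonempty :=
    ⟨⊥, fun v p hp => (isAcyclic_bot p hp).elim, fun v => by simp [nbrs]⟩
  obtain ⟨G, ⟨hG, hdeg⟩, hmax⟩ := (Set.toFinite
    {G : SimpleGraph V | NoShortCycle G g ∧ ∀ v, (nbrs G v).card ≤ d}).exists_maximal hne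
  refine ⟨G, hG, hdeg, ?_⟩
  rcases (univ.filter fun v => (nbrs G v).card < d).eq_empty_or_nonempty with h | ⟨x, hx⟩
  · simp [h]
  have hxd : (nbrs G x).card < d := (Finset.mem_filter.mp hx).2
  have hsub : (univ.filter fun v => (nbrs G v).card < d) ⊆ ball G {x} g := by
    intro y hy
    have hyd : (nbrs G y).card < d := (Finset.mem_filter.mp hy).2
    suffices h : ∃ p : G.Walk x y, p.length ≤ g by
      obtain ⟨p, hp⟩ := h
      have := mem_ball_add_length p 0 (S := {x}) (by simp [ball])
      exact ball_mono G {x} (by omega) this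
    by_contra! hfar
    have hxy : x ≠ y := by
      rintro rfl
      simpa using hfar Walk.nil
    have hle : G ⊔ edge x y ≤ G := by
      refine hmax ⟨hG.sup_edge hfar, fun v => ?_⟩ le_sup_left
      by_cases hv : v = x ∨ v = y
      · have hsub : ∃ z, nbrs (G ⊔ edge x y) v ⊆ insert z (nbrs G v) := by
          rcases hv with rfl | rfl
          · refine ⟨y, fun w hw => ?_⟩
            rw [mem_nbrs, sup_adj, edge_adj] at hw
            rw [Finset.mem_insert, mem_nbrs]
            grind
          · refine ⟨x, fun w hw => ?_⟩
            rw [mem_nbrs, sup_adj, edge_adj] at hw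
            rw [Finset.mem_insert, mem_nbrs]
            grind
        obtain ⟨z, hz⟩ := hsub
        have h1 := (Finset.card_le_card hz).trans (Finset.card_insert_le _ _)
        have h2 : (nbrs G v).card < d := by
          rcases hv with rfl | rfl <;> assumption
        omega
      · refine (Finset.card_le_card fun w hw => ?_).trans (hdeg v)
        rw [mem_nbrs, sup_adj, edge_adj] at hw
        rw [mem_nbrs]
        grind
    have hadj : G.Adj x y := hle (Or.inr (by rw [edge_adj]; exact ⟨Or.inl ⟨rfl, rfl⟩, hxy⟩))
    have h1 := hfar hadj.toWalk
    rw [Walk.length_cons, Walk.length_nil] at h1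
    omega
  calc _ ≤ (ball G {x} g).card := Finset.card_le_card hsub
    _ ≤ (d + 1) ^ g := by simpa using card_ball_le hdeg {x} g

end Counting

section PathCounting

variable {V : Type*} [Fintype V]

/-- The paths with `k` edges whose first vertex does not lie in `B`. -/
noncomputable def pathFuns (G : SimpleGraph V) (B : Finset V) (k : ℕ) :
    Finset (Fin (k + 1) → V) :=
  univ.filter fun u => IsPathFun G u ∧ u 0 ∉ B

theorem mem_pathFuns {G : SimpleGraph V} {B : Finset V} {k : ℕ} {u : Fin (k + 1) → V} :
    u ∈ pathFuns G B k ↔ IsPathFun G u ∧ u 0 ∉ B := by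
  simp [pathFuns]

theorem notMem_of_mem_pathFuns {G : SimpleGraph V} {S : Finset V} {k t : ℕ} (hkt : k ≤ t)
    {u : Fin (k + 1) → V} (hu : u ∈ pathFuns G (ball G S t) k) (i : Fin (k + 1)) :
    u i ∉ S := by
  intro hi
  rw [mem_pathFuns] at hu
  obtain ⟨p, -, hp, -⟩ := hu.1.exists_path (Fin.zero_le i)
  have := mem_ball_add_length p.reverse 0 (S := S) hi
  refine hu.2 (ball_mono G S ?_ this)
  rw [Walk.length_reverse, hp]
  omega

/-- In a graph with unique short paths, at most one neighbour of the endpoint of a path lies on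
the path. -/
theorem IsPathFun.card_nbrs_inter_le {G : SimpleGraph V} {K k : ℕ} (hG : UniqueShortPaths G K)
    (hK : 0 < K) (hk : k ≤ K) {u : Fin (k + 1) → V} (hu : IsPathFun G u) :
    (nbrs G (u (Fin.last k)) ∩ univ.image u).card ≤ 1 := by
  have key : ∀ i, G.Adj (u (Fin.last k)) (u i) → (i : ℕ) + 1 = k := by
    intro i hi
    obtain ⟨p, hp, hl, -⟩ := hu.exists_path (Fin.le_last i)
    have := hG _ _ p hi.symm.toWalk hp (by simpa using hi.symm.ne)
      (by rw [hl]; simp only [Fin.val_last]; omega) (by simpa [Nat.one_le_iff_ne_zero] using hK.ne')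
    have := congrArg Walk.length this
    rw [hl] at this
    simp at this
    omega
  rw [Finset.card_le_one]
  intro a ha b hb
  simp only [Finset.mem_inter, mem_nbrs, Finset.mem_image, Finset.mem_univ, true_and] at ha hb
  obtain ⟨ha, i, rfl⟩ := ha
  obtain ⟨hb, j, rfl⟩ := hb
  have := key i ha
  have := key j hb
  congr 1
  ext
  omega

theorem card_pathFuns_succ {G : SimpleGraph V} {S : Finset V} {K k t d : ℕ}
    (hG : UniqueShortPaths G K) (hK : 0 < K) (htK : t ≤ K) (hkt : k < t)
    (hdeg : ∀ v, v ∉ S → d ≤ (nbrs G v).card) :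
    (pathFuns G (ball G S t) k).card * (d - 1) ≤ (pathFuns G (ball G S t) (k + 1)).card := by
  let E := (pathFuns G (ball G S t) k).sigma
    fun u => nbrs G (u (Fin.last k)) \ univ.image u
  have h1 : (pathFuns G (ball G S t) k).card * (d - 1) ≤ E.card := by
    rw [Finset.card_sigma, ← smul_eq_mul]
    refine Finset.card_nsmul_le_sum _ _ _ fun u hu => ?_
    have h2 := (mem_pathFuns.mp hu).1.card_nbrs_inter_le hG hK (by omega)
    have h3 := hdeg _ (notMem_of_mem_pathFuns hkt.le hu (Fin.last k))
    have h4 := Finset.card_sdiff_add_card_inter (nbrs G (u (Fin.last k))) (univ.image u)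
    omega
  refine h1.trans ?_
  refine Finset.card_le_card_of_injOn
    (fun x => (Fin.snoc x.1 x.2 : Fin (k + 1 + 1) → V)) ?_ ?_
  · rintro ⟨u, w⟩ hx
    simp only [E, Finset.coe_sigma, Set.mem_sigma_iff, Finset.mem_coe, Finset.mem_sdiff, mem_nbrs,
      Finset.mem_image, Finset.mem_univ, true_and, not_exists] at hx
    obtain ⟨hu, hadj, hw⟩ := hx
    rw [Finset.mem_coe, mem_pathFuns]
    refine ⟨(mem_pathFuns.mp hu).1.snoc hadj hw, ?_⟩
    have : (Fin.snoc u w : Fin (k + 1 + 1) → V) 0 = u 0 := by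
      rw [← Fin.castSucc_zero, Fin.snoc_castSucc (α := fun _ => V)]
    simpa only [this] using (mem_pathFuns.mp hu).2
  · rintro ⟨u, w⟩ - ⟨u', w'⟩ - h
    obtain ⟨rfl, rfl⟩ : u = u' ∧ w = w' := Fin.snoc_injective2 h
    rfl

theorem card_pathFuns {G : SimpleGraph V} {S : Finset V} {K t d : ℕ}
    (hG : UniqueShortPaths G K) (hK : 0 < K) (htK : t ≤ K)
    (hdeg : ∀ v, v ∉ S → d ≤ (nbrs G v).card) {k : ℕ} (hkt : k ≤ t) :
    (univ \ ball G S t).card * (d - 1) ^ k ≤ (pathFuns G (ball G S t) k).card := by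
  induction k with
  | zero =>
    rw [pow_zero, mul_one]
    refine Finset.card_le_card_of_injOn (fun v _ => v) ?_ ?_
    · intro v hv
      rw [Finset.mem_coe, mem_pathFuns]
      exact ⟨⟨fun i => i.elim0, fun a b _ => Subsingleton.elim (α := Fin 1) a b⟩,
        (Finset.mem_sdiff.mp hv).2⟩
    · exact fun a _ b _ h => congrFun h 0
  | succ k ih =>
    calc _ = (univ \ ball G S t).card * (d - 1) ^ k * (d - 1) := by ring
      _ ≤ _ := Nat.mul_le_mul_right _ (ih (by omega))
      _ ≤ _ := card_pathFuns_succ hG hK htK (by omega) hdeg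

theorem sum_prod_le_of_row_sum_le (M : V → V → ℕ) (b : ℕ) (hM : ∀ x, ∑ y, M x y ≤ b) (k : ℕ) :
    ∑ u : Fin (k + 1) → V, ∏ i : Fin k, M (u i.castSucc) (u i.succ) ≤ Fintype.card V * b ^ k := by
  induction k with
  | zero => simp
  | succ k ih =>
    rw [← (Fin.snocEquiv fun _ : Fin (k + 1 + 1) => V).sum_comp, Fintype.sum_prod_type,
      Finset.sum_comm]
    have : ∀ (u : Fin (k + 1) → V), ∑ w : V, ∏ i : Fin (k + 1),
        M ((Fin.snocEquiv fun _ : Fin (k + 1 + 1) => V) (w, u) i.castSucc)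
          ((Fin.snocEquiv fun _ : Fin (k + 1 + 1) => V) (w, u) i.succ) ≤
        (∏ i : Fin k, M (u i.castSucc) (u i.succ)) * b := by
      intro u
      simp only [Fin.prod_univ_castSucc, Fin.snocEquiv_apply, Fin.succ_castSucc, Fin.succ_last,
        Fin.snoc_castSucc, Fin.snoc_last]
      rw [← Finset.mul_sum]
      exact Nat.mul_le_mul_left _ (hM _)
    calc _ ≤ ∑ u : Fin (k + 1) → V, (∏ i : Fin k, M (u i.castSucc) (u i.succ)) * b :=
          Finset.sum_le_sum fun u _ => this u
      _ ≤ Fintype.card V * b ^ k * b := by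
          rw [← Finset.sum_mul]
          exact Nat.mul_le_mul_right _ ih
      _ = _ := by ring

theorem sum_prod_le_of_col_sum_le (M : V → V → ℕ) (b : ℕ) (hM : ∀ y, ∑ x, M x y ≤ b) (k : ℕ) :
    ∑ u : Fin (k + 1) → V, ∏ i : Fin k, M (u i.castSucc) (u i.succ) ≤ Fintype.card V * b ^ k := by
  refine le_trans (le_of_eq ?_) (sum_prod_le_of_row_sum_le (fun x y => M y x) b hM k)
  rw [← (Equiv.arrowCongr (Fin.revPerm (n := k + 1)) (Equiv.refl V)).sum_comp]
  refine Finset.sum_congr rfl fun u _ => ?_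
  rw [← Equiv.prod_comp (Fin.revPerm (n := k))]
  simp [Fin.rev_castSucc, Fin.rev_succ]

/-- Markov's inequality for the number of `R`-walks at least a quarter of whose steps lie
in `A`. -/
theorem card_filter_mul_pow_le (R A : V → V → Prop) (q b k : ℕ) (hq : 0 < q)
    (hsum : ∑ u : Fin (k + 1) → V, ∏ i : Fin k,
      (if R (u i.castSucc) (u i.succ) then
        (if A (u i.castSucc) (u i.succ) then q ^ 4 else 1) else 0) ≤ b) :
    (univ.filter fun u : Fin (k + 1) → V => (∀ i : Fin k, R (u i.castSucc) (u i.succ)) ∧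
      k ≤ 4 * (univ.filter fun i : Fin k => A (u i.castSucc) (u i.succ)).card).card * q ^ k
      ≤ b := by
  refine le_trans ?_ hsum
  rw [← smul_eq_mul]
  refine (Finset.card_nsmul_le_sum _ (fun u : Fin (k + 1) → V => ∏ i : Fin k,
      (if R (u i.castSucc) (u i.succ) then
        (if A (u i.castSucc) (u i.succ) then q ^ 4 else 1) else 0)) _ fun u hu => ?_).trans
    (Finset.sum_le_sum_of_subset (Finset.filter_subset _ _))
  obtain ⟨-, hR, hk⟩ := Finset.mem_filter.mp hu
  rw [Finset.prod_congr rfl fun i _ => if_pos (hR i), Finset.prod_ite, Finset.prod_const,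
    Finset.prod_const_one, mul_one, ← pow_mul]
  exact Nat.pow_le_pow_right hq hk

theorem sum_ite_adj_le {G : SimpleGraph V} {d : ℕ} (hdeg : ∀ v, (nbrs G v).card ≤ d)
    (a : V → V) (x : V) :
    ∑ y, (if G.Adj x y then (if a x = y then d else 1) else 0) ≤ 2 * d := by
  calc ∑ y, (if G.Adj x y then (if a x = y then d else 1) else 0)
      ≤ ∑ y, ((if G.Adj x y then 1 else 0) + if a x = y then d else 0) := by
        refine Finset.sum_le_sum fun y _ => ?_
        split_ifs <;> omega
    _ = (nbrs G x).card + d := by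
        rw [Finset.sum_add_distrib, Finset.sum_boole, Finset.sum_ite_eq]
        simp [nbrs]
    _ ≤ 2 * d := by have := hdeg x; omega

/-- The walks of length `k` that follow the map `a` often, forwards or backwards, are few. -/
theorem card_filter_follow_le {G : SimpleGraph V} {q : ℕ} (hq : 0 < q)
    (hdeg : ∀ v, (nbrs G v).card ≤ q ^ 4) (a : V → V) (k : ℕ) :
    (univ.filter fun u : Fin (k + 1) → V => IsPathFun G u ∧
      (k + 1 : ℕ) ≤ 2 * ((univ.filter fun i : Fin k => a (u i.castSucc) = u i.succ).card +
        (univ.filter fun i : Fin k => a (u i.succ) = u i.castSucc).card)).card * q ^ k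
      ≤ 2 * (Fintype.card V * (2 * q ^ 4) ^ k) := by
  have h1 := card_filter_mul_pow_le G.Adj (fun x y => a x = y) q _ k hq
    (sum_prod_le_of_row_sum_le
      (fun x y => if G.Adj x y then (if a x = y then q ^ 4 else 1) else 0) _
      (sum_ite_adj_le hdeg a) k)
  have h2 := card_filter_mul_pow_le G.Adj (fun x y => a y = x) q _ k hq
    (sum_prod_le_of_col_sum_le
      (fun x y => if G.Adj x y then (if a y = x then q ^ 4 else 1) else 0) _
      (fun y => by simpa only [G.adj_comm y] using sum_ite_adj_le hdeg a y) k)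
  rw [two_mul (Fintype.card V * _)]
  refine le_trans ?_ (add_le_add h1 h2)
  rw [← add_mul]
  refine Nat.mul_le_mul_right _ ((Finset.card_le_card fun u hu => ?_).trans
    (Finset.card_union_le _ _))
  obtain ⟨-, hP, hk⟩ := Finset.mem_filter.mp hu
  rw [Finset.mem_union, Finset.mem_filter, Finset.mem_filter]
  by_contra! hcon
  have h3 := hcon.1 (Finset.mem_univ _) hP.adj
  have h4 := hcon.2 (Finset.mem_univ _) hP.adj
  omega

end PathCounting

section Metric

variable {V : Type*}

/-- The graph distance truncated at `K`. -/
noncomputable def truncDist (G : SimpleGraph V) (K : ℕ) (u v : V) : ℕ :=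
  (min (G.edist u v) K).toNat

theorem coe_truncDist (G : SimpleGraph V) (K : ℕ) (u v : V) :
    (truncDist G K u v : ℕ∞) = min (G.edist u v) K :=
  ENat.natCast_toNat (ne_top_of_le_ne_top (ENat.natCast_ne_top K) (min_le_right _ _))

theorem truncDist_le (G : SimpleGraph V) (K : ℕ) (u v : V) : truncDist G K u v ≤ K := by
  have := coe_truncDist G K u v
  exact_mod_cast this.le.trans (min_le_right _ _)

theorem truncDist_le_length {G : SimpleGraph V} (K : ℕ) {u v : V} (p : G.Walk u v) :
    truncDist G K u v ≤ p.length := by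
  have := coe_truncDist G K u v
  exact_mod_cast (this.le.trans (min_le_left _ _)).trans (edist_le p)

theorem truncDist_comm (G : SimpleGraph V) (K : ℕ) (u v : V) :
    truncDist G K u v = truncDist G K v u := by
  rw [truncDist, truncDist, edist_comm]

theorem exists_path_of_truncDist_lt {G : SimpleGraph V} {K : ℕ} {u v : V}
    (h : truncDist G K u v < K) :
    ∃ p : G.Walk u v, p.IsPath ∧ p.length = truncDist G K u v := by
  have h1 := coe_truncDist G K u v
  have h2 : G.edist u v = (truncDist G K u v : ℕ∞) := by
    rcases min_choice (G.edist u v) (K : ℕ∞) with h3 | h3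
    · rw [h1, h3]
    · rw [h3] at h1
      have : truncDist G K u v = K := by exact_mod_cast h1
      omega
  obtain ⟨p, hp⟩ := exists_walk_of_edist_eq_coe h2
  refine ⟨p, ?_, hp⟩
  refine p.isPath_of_length_eq_dist ?_
  rw [hp, SimpleGraph.dist, h2]
  rfl

theorem truncDist_pos {G : SimpleGraph V} {K : ℕ} (hK : 0 < K) {u v : V} (h : u ≠ v) :
    0 < truncDist G K u v := by
  rw [Nat.pos_iff_ne_zero]
  intro h0
  obtain ⟨p, -, hp⟩ := exists_path_of_truncDist_lt (h0 ▸ hK : truncDist G K u v < K)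
  exact h (Walk.eq_of_length_eq_zero (hp.trans h0))

theorem truncDist_triangle (G : SimpleGraph V) (K : ℕ) (u v w : V) :
    truncDist G K u w ≤ truncDist G K u v + truncDist G K v w := by
  by_cases h1 : truncDist G K u v < K
  · by_cases h2 : truncDist G K v w < K
    · obtain ⟨p, -, hp⟩ := exists_path_of_truncDist_lt h1
      obtain ⟨q, -, hq⟩ := exists_path_of_truncDist_lt h2
      have := truncDist_le_length K (p.append q)
      rwa [Walk.length_append, hp, hq] at this
    · have := truncDist_le G K u w
      omega
  · have := truncDist_le G K u w
    omega

/-- The graph metric of `G`, in which the vertex `r` is moved to distance `L` from everything. -/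
noncomputable def rootDist (G : SimpleGraph V) (r : V) (L : ℕ) (u v : V) : ℝ :=
  if u = v then 0 else if u = r ∨ v = r then (L : ℝ) else truncDist G (2 * L) u v

theorem rootDist_isMetric (G : SimpleGraph V) (r : V) {L : ℕ} (hL : 0 < L) :
    IsMetric (rootDist G r L) where
  refl x := by simp [rootDist]
  pos x y h := by
    rw [rootDist, if_neg h]
    split_ifs
    · exact_mod_cast hL
    · exact_mod_cast truncDist_pos (by omega) h
  symm x y := by
    simp only [rootDist, truncDist_comm G (2 * L) x y, eq_comm (a := x) (b := y),
      or_comm (a := x = r)]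
  triangle x y z := by
    have h1 := truncDist_triangle G (2 * L) x y z
    have h2 := truncDist_le G (2 * L) x z
    simp only [rootDist]
    by_cases hxz : x = z
    · rw [if_pos hxz]
      positivity
    by_cases hxy : x = y
    · subst hxy; simp
    by_cases hyz : y = z
    · subst hyz; simp
    rw [if_neg hxz, if_neg hxy, if_neg hyz]
    by_cases hx : x = r
    · subst hx
      simp [Ne.symm hxz, Ne.symm hxy]
    by_cases hz : z = r
    · subst hz
      simp [hyz, hxz]
    by_cases hy : y = r
    · subst hy
      simp only [hxy, hz, or_self, if_false, or_true, true_or, if_true]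
      exact_mod_cast (by omega : truncDist G (2 * L) x z ≤ L + L)
    · simp only [hx, hy, hz, or_self, if_false]
      exact_mod_cast h1

theorem rootDist_root {G : SimpleGraph V} {r v : V} (L : ℕ) (h : v ≠ r) :
    rootDist G r L v r = L := by
  simp [rootDist, h]

theorem rootDist_le_length {G : SimpleGraph V} {r v w : V} (L : ℕ) (hv : v ≠ r) (hw : w ≠ r)
    (p : G.Walk v w) : rootDist G r L v w ≤ p.length := by
  simp only [rootDist, hv, hw, or_self, if_false]
  split_ifs
  · positivity
  · exact_mod_cast truncDist_le_length _ p

theorem exists_path_of_rootDist_lt {G : SimpleGraph V} {r v w : V} {L : ℕ} (hv : v ≠ r)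
    (hw : w ≠ r) (h : rootDist G r L v w < 2 * L) :
    ∃ p : G.Walk v w, p.IsPath ∧ (p.length : ℝ) = rootDist G r L v w := by
  by_cases hvw : v = w
  · subst hvw
    exact ⟨Walk.nil, Walk.IsPath.nil, by simp [rootDist]⟩
  · simp only [rootDist, hv, hw, hvw, or_self, if_false] at h ⊢
    obtain ⟨p, hp, hl⟩ := exists_path_of_truncDist_lt (G := G) (K := 2 * L) (u := v) (v := w)
      (by exact_mod_cast h)
    exact ⟨p, hp, by exact_mod_cast hl⟩

/-- The vertex `v` together with the vertices reached from `v` by paths of length less than `L`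
that start with the step from `v` to `a`. -/
def region (G : SimpleGraph V) (L : ℕ) (v a : V) : Set V :=
  {x | ∃ p : G.Walk v x, p.IsPath ∧ p.length < L ∧ (¬ p.Nil → p.snd = a)}

/-- A path from outside a region at `v` to a vertex inside passes through `v`. -/
theorem rootDist_le_of_mem_region {G : SimpleGraph V} {r v a x y : V} {L : ℕ}
    (hG : UniqueShortPaths G (2 * L)) (hv : v ≠ r) (hy : y ≠ r)
    (hx : rootDist G r L v x < L) (hxa : x ∉ region G L v a) (hya : y ∈ region G L v a) :
    rootDist G r L v y ≤ rootDist G r L x y := by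
  have hxr : x ≠ r := by
    rintro rfl
    rw [rootDist_root L hv] at hx
    exact lt_irrefl _ hx
  have hL : (0 : ℝ) ≤ L := Nat.cast_nonneg L
  obtain ⟨p, hp, hpl⟩ := exists_path_of_rootDist_lt hv hxr (by linarith : _ < 2 * (L : ℝ))
  have hpL : p.length < L := by
    rw [← hpl] at hx
    exact_mod_cast hx
  obtain ⟨q, hq, hqL, hqa⟩ := hya
  have hpa : ¬ p.Nil ∧ p.snd ≠ a := by
    by_contra! hcon
    exact hxa ⟨p, hp, hpL, hcon⟩
  have happ : (p.reverse.append q).IsPath := hG.isPath_reverse_append hp hq (by omega) (by omega)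
    fun _ h2 => by rw [hqa h2]; exact hpa.2
  have hlen : (p.reverse.append q).length = p.length + q.length := by
    rw [Walk.length_append, Walk.length_reverse]
  have hlt : rootDist G r L x y < 2 * L := by
    refine (rootDist_le_length L hxr hy (p.reverse.append q)).trans_lt ?_
    rw [hlen]
    exact_mod_cast (by omega : p.length + q.length < 2 * L)
  obtain ⟨s, hs, hsl⟩ := exists_path_of_rootDist_lt hxr hy hlt
  have hs2 : s.length ≤ 2 * L := by
    rw [← hsl] at hlt
    exact_mod_cast hlt.le
  have := hG _ _ s _ hs happ hs2 (by omega)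
  rw [← hsl, this, hlen]
  refine (rootDist_le_length L hv hy q).trans ?_
  exact_mod_cast Nat.le_add_left _ _

theorem sym2Cost_mk {c : V → V → ℝ} (hc : IsMetric c) (x y : V) : sym2Cost c s(x, y) = c x y := by
  simp only [sym2Cost, Sym2.lift_mk, hc.symm y x]
  ring

theorem sym2Cost_nonneg {c : V → V → ℝ} (hc : IsMetric c) (e : Sym2 V) : 0 ≤ sym2Cost c e := by
  induction e with
  | _ x y =>
    rw [sym2Cost_mk hc]
    by_cases h : x = y
    · rw [h, hc.refl]
    · exact (hc.pos x y h).le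

end Metric

section Paths

variable {V : Type*} [DecidableEq V]

theorem listEdges_cons_cons (x y : V) (l : List V) :
    listEdges (x :: y :: l) = insert s(x, y) (listEdges (y :: l)) := by
  simp [listEdges]

theorem mem_of_mem_listEdges {l : List V} {e : Sym2 V} (he : e ∈ listEdges l) {x : V}
    (hx : x ∈ e) : x ∈ l := by
  simp only [listEdges, List.mem_toFinset, List.mem_map, Prod.exists] at he
  obtain ⟨a, b, hab, rfl⟩ := he
  have := List.of_mem_zip hab
  rcases Sym2.mem_iff.mp hx with rfl | rfl
  · exact this.1
  · exact List.mem_of_mem_tail this.2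

theorem mk_notMem_listEdges {x y : V} {l : List V} (h : (x :: y :: l).Nodup) :
    s(x, y) ∉ listEdges (y :: l) := fun he =>
  (List.nodup_cons.mp h).1 (mem_of_mem_listEdges he (Sym2.mem_mk_left x y))

theorem exists_region_le_cost_of_list {G : SimpleGraph V} {r v : V} {L : ℕ} (hL : 0 < L)
    (hG : UniqueShortPaths G (2 * L)) (hv : v ≠ r) :
    ∀ (l : List V) (x : V), (x :: l).Nodup → (x :: l).getLast? = some r →
      rootDist G r L v x < L →
      ∃ a, (L : ℝ) ≤ (if x ∈ region G L v a then rootDist G r L v x else 0) +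
        ∑ e ∈ (listEdges (x :: l)).filter (fun e => ∃ z ∈ e, z ∈ region G L v a),
          sym2Cost (rootDist G r L) e := by
  have hc := rootDist_isMetric G r hL
  have hnn : ∀ x y, 0 ≤ rootDist G r L x y := fun x y => by
    rw [← sym2Cost_mk hc]
    exact sym2Cost_nonneg hc _
  have hroot : ∀ {x}, rootDist G r L v x < L → x ≠ r := by
    rintro x hx rfl
    rw [rootDist_root L hv] at hx
    exact lt_irrefl _ hx
  intro l
  induction l with
  | nil =>
    intro x _ hlast hx
    exact absurd (by simpa using hlast) (hroot hx)
  | cons y l ih =>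
    intro x hnd hlast hx
    have hins : ∀ a, (x ∈ region G L v a ∨ y ∈ region G L v a) →
        ∑ e ∈ (listEdges (x :: y :: l)).filter (fun e => ∃ z ∈ e, z ∈ region G L v a),
          sym2Cost (rootDist G r L) e = rootDist G r L x y +
        ∑ e ∈ (listEdges (y :: l)).filter (fun e => ∃ z ∈ e, z ∈ region G L v a),
          sym2Cost (rootDist G r L) e := by
      intro a ha
      rw [listEdges_cons_cons, Finset.filter_insert, if_pos (by simpa using ha),
        Finset.sum_insert (fun h => mk_notMem_listEdges hnd (Finset.mem_of_mem_filter _ h)),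
        sym2Cost_mk hc]
    by_cases hy : rootDist G r L v y < L
    · obtain ⟨a, ha⟩ := ih y (List.nodup_cons.mp hnd).2 (by simpa using hlast) hy
      refine ⟨a, ?_⟩
      by_cases hya : y ∈ region G L v a
      · rw [if_pos hya] at ha
        rw [hins a (Or.inr hya)]
        by_cases hxa : x ∈ region G L v a
        · rw [if_pos hxa]
          have := hc.triangle v x y
          linarith
        · rw [if_neg hxa]
          have := rootDist_le_of_mem_region hG hv (hroot hy) hx hxa hya
          linarith
      · rw [if_neg hya, zero_add] at ha
        have h1 : 0 ≤ if x ∈ region G L v a then rootDist G r L v x else 0 := by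
          split_ifs
          · exact hnn _ _
          · exact le_rfl
        refine ha.trans ((le_add_of_nonneg_left h1).trans' ?_)
        refine Finset.sum_le_sum_of_subset_of_nonneg (Finset.filter_subset_filter _ ?_)
          fun e _ _ => sym2Cost_nonneg hc e
        rw [listEdges_cons_cons]
        exact Finset.subset_insert _ _
    · have hL' : (0 : ℝ) < L := by exact_mod_cast hL
      obtain ⟨p, hp, hpl⟩ := exists_path_of_rootDist_lt hv (hroot hx)
        (by linarith : _ < 2 * (L : ℝ))
      have hxa : x ∈ region G L v p.snd := by
        refine ⟨p, hp, ?_, fun _ => rfl⟩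
        rw [← hpl] at hx
        exact_mod_cast hx
      refine ⟨p.snd, ?_⟩
      rw [hins _ (Or.inl hxa), if_pos hxa]
      have h1 := hc.triangle v x y
      have h2 : 0 ≤ ∑ e ∈ (listEdges (y :: l)).filter
          (fun e => ∃ z ∈ e, z ∈ region G L v p.snd), sym2Cost (rootDist G r L) e :=
        Finset.sum_nonneg fun e _ => sym2Cost_nonneg hc e
      linarith

/-- Every path from `v` to the root spends cost at least `L` on edges touching a single region
at `v`. -/
theorem exists_region_le_cost {G : SimpleGraph V} {r v : V} {L : ℕ} (hL : 0 < L)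
    (hG : UniqueShortPaths G (2 * L)) (hv : v ≠ r) (p : RootPath V v r) :
    ∃ a, (L : ℝ) ≤ ∑ e ∈ (listEdges p.1).filter (fun e => ∃ z ∈ e, z ∈ region G L v a),
      sym2Cost (rootDist G r L) e := by
  obtain ⟨l, hnd, hhead, hlast⟩ := p
  obtain ⟨l, rfl⟩ : ∃ l', l = v :: l' := by
    cases l with
    | nil => simp at hhead
    | cons x l => exact ⟨l, by simpa using hhead⟩
  have h0 : rootDist G r L v v = 0 := (rootDist_isMetric G r hL).refl v
  obtain ⟨a, ha⟩ := exists_region_le_cost_of_list hL hG hv l v hnd hlast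
    (by rw [h0]; exact_mod_cast hL)
  refine ⟨a, ?_⟩
  simpa only [h0, ite_self, zero_add] using ha

end Paths

section LowerBound

variable {V : Type*}

theorem disjoint_region {G : SimpleGraph V} {k L : ℕ} (hG : UniqueShortPaths G (2 * L))
    (hk : k ≤ L) {u : Fin (k + 1) → V} (hu : IsPathFun G u) {i j : Fin (k + 1)} (hij : i < j)
    {a b : V} (ha : ∀ m : Fin (k + 1), (m : ℕ) = i + 1 → a ≠ u m)
    (hb : ∀ m : Fin (k + 1), (m : ℕ) + 1 = j → b ≠ u m) :
    Disjoint (region G L (u i) a) (region G L (u j) b) := by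
  rw [Set.disjoint_left]
  rintro x ⟨p, hp, hpL, hpa⟩ ⟨q, hq, hqL, hqb⟩
  obtain ⟨s, hs, hsl, hsv⟩ := hu.exists_path hij.le
  have hij' : (i : ℕ) < j := hij
  have hsnil : 0 < s.length := by omega
  have hrev : s.reverse.snd = u ⟨j - 1, by omega⟩ := by
    rw [Walk.snd_reverse, Walk.penultimate, hsl]
    have := hsv ⟨j - 1, by omega⟩ (Fin.mk_le_mk.mpr (by omega)) (Fin.mk_le_mk.mpr (by omega))
    rw [← this]
    congr 1
    simp only []
    omega
  have hsnd : s.snd = u ⟨i + 1, by omega⟩ := by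
    have := hsv ⟨i + 1, by omega⟩ (Fin.mk_le_mk.mpr (by omega)) (Fin.mk_le_mk.mpr (by omega))
    simpa using this
  have happ : (s.append q).IsPath := by
    have := hG.isPath_reverse_append hs.reverse hq (by rw [Walk.length_reverse]; omega) (by omega)
      fun _ h2 => by
        rw [hrev, hqb h2]
        exact (hb _ (by simp only []; omega)).symm
    rwa [Walk.reverse_reverse] at this
  have hlen : (s.append q).length = s.length + q.length := Walk.length_append _ _
  have heq := hG _ _ p _ hp happ (by omega) (by omega)
  have hpn : ¬ p.Nil := by
    rw [← Walk.length_eq_zero_iff, heq, hlen]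
    omega
  refine ha ⟨i + 1, by omega⟩ rfl ?_
  rw [← hpa hpn, heq, ← hsnd, Walk.snd, Walk.snd, Walk.getVert_append]
  split_ifs with h1
  · rfl
  · have : s.length = 1 := by omega
    rw [this, Nat.sub_self, Walk.getVert_zero, ← this, Walk.getVert_length]

/-- The indices at which the direction `a` leaves the path `u`. -/
noncomputable def leavingIndices {k : ℕ} (u : Fin (k + 1) → V) (a : V → V) :
    Finset (Fin (k + 1)) :=
  univ.filter fun i => (∀ j : Fin k, j.castSucc = i → a (u i) ≠ u j.succ) ∧
    ∀ j : Fin k, j.succ = i → a (u i) ≠ u j.castSucc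

theorem mem_leavingIndices {k : ℕ} {u : Fin (k + 1) → V} {a : V → V} {i : Fin (k + 1)} :
    i ∈ leavingIndices u a ↔ (∀ j : Fin k, j.castSucc = i → a (u i) ≠ u j.succ) ∧
      ∀ j : Fin k, j.succ = i → a (u i) ≠ u j.castSucc := by
  simp [leavingIndices]

theorem le_card_leavingIndices {k : ℕ} (u : Fin (k + 1) → V) (a : V → V) :
    k + 1 ≤ (leavingIndices u a).card +
      ((univ.filter fun i : Fin k => a (u i.castSucc) = u i.succ).card +
        (univ.filter fun i : Fin k => a (u i.succ) = u i.castSucc).card) := by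
  have hcover : (univ : Finset (Fin (k + 1))) ⊆ leavingIndices u a ∪
      ((univ.filter fun i : Fin k => a (u i.castSucc) = u i.succ).image Fin.castSucc ∪
        (univ.filter fun i : Fin k => a (u i.succ) = u i.castSucc).image Fin.succ) := by
    intro i _
    by_contra hi
    simp only [Finset.mem_union, not_or, Finset.mem_image, Finset.mem_filter, Finset.mem_univ,
      true_and, not_exists, not_and, mem_leavingIndices] at hi
    refine hi.1 (fun j hj hcon => hi.2.1 j ?_ hj) (fun j hj hcon => hi.2.2 j ?_ hj)
    · rw [hj]; exact hcon
    · rw [hj]; exact hcon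
  have h1 := Finset.card_le_card hcover
  rw [Finset.card_univ, Fintype.card_fin] at h1
  refine h1.trans ((Finset.card_union_le _ _).trans (Nat.add_le_add_left ?_ _))
  exact (Finset.card_union_le _ _).trans (add_le_add Finset.card_image_le Finset.card_image_le)

variable [DecidableEq V]

theorem card_leavingIndices_mul_le {G : SimpleGraph V} {r : V} {k L : ℕ} (hL : 0 < L)
    (hG : UniqueShortPaths G (2 * L)) (hk : k ≤ L) {u : Fin (k + 1) → V} (hu : IsPathFun G u)
    (hr : ∀ i, u i ≠ r) (P : PathSystem V r) {a : V → V}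
    (ha : ∀ v, v ≠ r → (L : ℝ) ≤
      ∑ e ∈ (listEdges (P v).1).filter (fun e => ∃ z ∈ e, z ∈ region G L v (a v)),
        sym2Cost (rootDist G r L) e) :
    (leavingIndices u a).card * (L : ℝ) ≤
      2 * pathSystemCost (rootDist G r L) P (univ.image u) := by
  have hc := rootDist_isMetric G r hL
  have hdisj : ∀ z, ((leavingIndices u a).filter
      fun i => z ∈ region G L (u i) (a (u i))).card ≤ 1 := by
    intro z
    rw [Finset.card_le_one]
    have key : ∀ i ∈ leavingIndices u a, ∀ j ∈ leavingIndices u a, i < j →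
        z ∈ region G L (u i) (a (u i)) → z ∉ region G L (u j) (a (u j)) := by
      intro i hi j hj hij hzi hzj
      rw [mem_leavingIndices] at hi hj
      refine Set.disjoint_left.mp (disjoint_region hG hk hu hij ?_ ?_) hzi hzj
      · intro m hm
        have := hi.1 ⟨i, by omega⟩ (by ext; simp)
        convert this using 2
        ext; simp [hm]
      · intro m hm
        have := hj.2 ⟨m, by omega⟩ (by ext; simp [hm])
        convert this using 2
        rfl
    intro i hi j hj
    rw [Finset.mem_filter] at hi hj
    rcases lt_trichotomy i j with h | h | h
    · exact absurd hj.2 (key i hi.1 j hj.1 h hi.2)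
    · exact h
    · exact absurd hi.2 (key j hj.1 i hi.1 h hj.2)
  have htouch : ∀ e : Sym2 V, ((leavingIndices u a).filter
      fun i => ∃ z ∈ e, z ∈ region G L (u i) (a (u i))).card ≤ 2 := by
    intro e
    induction e with
    | _ x y =>
      refine (Finset.card_le_card (t := (leavingIndices u a).filter
        (fun i => x ∈ region G L (u i) (a (u i))) ∪ (leavingIndices u a).filter
        (fun i => y ∈ region G L (u i) (a (u i)))) ?_).trans
        ((Finset.card_union_le _ _).trans (add_le_add (hdisj x) (hdisj y)))
      intro i hi
      simp only [Finset.mem_filter, Sym2.mem_iff, exists_eq_or_imp, exists_eq_left] at hi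
      simp only [Finset.mem_union, Finset.mem_filter]
      tauto
  let E := (univ.image u).biUnion fun v => listEdges (P v).1
  calc (leavingIndices u a).card * (L : ℝ)
      = ∑ _i ∈ leavingIndices u a, (L : ℝ) := by rw [Finset.sum_const, nsmul_eq_mul]
    _ ≤ ∑ i ∈ leavingIndices u a, ∑ e ∈ E,
        if ∃ z ∈ e, z ∈ region G L (u i) (a (u i)) then sym2Cost (rootDist G r L) e else 0 := by
        refine Finset.sum_le_sum fun i _ => (ha (u i) (hr i)).trans ?_
        rw [← Finset.sum_filter]
        refine Finset.sum_le_sum_of_subset_of_nonneg (Finset.filter_subset_filter _ ?_)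
          fun e _ _ => sym2Cost_nonneg hc e
        exact Finset.subset_biUnion_of_mem (fun v => listEdges (P v).1)
          (Finset.mem_image_of_mem u (Finset.mem_univ i))
    _ = ∑ e ∈ E, ((leavingIndices u a).filter
        fun i => ∃ z ∈ e, z ∈ region G L (u i) (a (u i))).card *
          sym2Cost (rootDist G r L) e := by
        rw [Finset.sum_comm]
        refine Finset.sum_congr rfl fun e _ => ?_
        rw [← Finset.sum_filter, Finset.sum_const, nsmul_eq_mul]
    _ ≤ ∑ e ∈ E, 2 * sym2Cost (rootDist G r L) e :=
        Finset.sum_le_sum fun e _ =>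
          mul_le_mul_of_nonneg_right (by exact_mod_cast htouch e) (sym2Cost_nonneg hc e)
    _ = 2 * pathSystemCost (rootDist G r L) P (univ.image u) := by
        rw [← Finset.mul_sum, pathSystemCost]

/-- Every path system follows a single direction at each vertex, and pays for each index at which
that direction leaves a path of `G`. -/
theorem exists_direction {G : SimpleGraph V} {r : V} {k L : ℕ} (hL : 0 < L)
    (hG : UniqueShortPaths G (2 * L)) (hk : k ≤ L) (P : PathSystem V r) :
    ∃ a : V → V, ∀ u : Fin (k + 1) → V, IsPathFun G u → (∀ i, u i ≠ r) →
      (leavingIndices u a).card * (L : ℝ) ≤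
        2 * pathSystemCost (rootDist G r L) P (univ.image u) := by
  have hex : ∀ v, ∃ a, v ≠ r → (L : ℝ) ≤
      ∑ e ∈ (listEdges (P v).1).filter (fun e => ∃ z ∈ e, z ∈ region G L v a),
        sym2Cost (rootDist G r L) e := fun v => by
    by_cases hv : v = r
    · exact ⟨v, fun h => absurd hv h⟩
    · obtain ⟨a, ha⟩ := exists_region_le_cost hL hG hv (P v)
      exact ⟨a, fun _ => ha⟩
  choose a ha using hex
  exact ⟨a, fun u hu hr => card_leavingIndices_mul_le hL hG hk hu hr P ha⟩

end LowerBound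

section Steiner

variable {V : Type*} [Fintype V] [DecidableEq V]

theorem optST_le_of_path {c : V → V → ℝ} (hc : IsMetric c) {m : ℕ} {f : Fin (m + 1) → V}
    (hf : Function.Injective f) {X : Finset V} (hX : X ⊆ univ.image f) :
    optST c (f 0) X ≤ ∑ i : Fin m, c (f i.castSucc) (f i.succ) := by
  obtain ⟨T, hT, htree⟩ := (pathGraph_connected m).exists_isTree_le
  let φ : Fin (m + 1) ↪ V := ⟨f, hf⟩
  have hedge : ∀ e ∈ (T.map φ).edgeSet, ∃ i : Fin m, s(f i.castSucc, f i.succ) = e := by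
    intro e he
    induction e with
    | _ x y =>
      rw [mem_edgeSet, map_adj] at he
      obtain ⟨a, b, hab, rfl, rfl⟩ := he
      rcases pathGraph_adj.mp (hT hab) with h | h
      · refine ⟨⟨a, by omega⟩, ?_⟩
        have : (⟨a, by omega⟩ : Fin m).succ = b := by ext; simpa using h
        rw [this]
        rfl
      · refine ⟨⟨b, by omega⟩, ?_⟩
        have : (⟨b, by omega⟩ : Fin m).succ = a := by ext; simpa using h
        rw [this, Sym2.eq_swap]
        rfl
  have hmem : ∑ e ∈ univ.filter (fun e : Sym2 V => e ∈ (T.map φ).edgeSet), sym2Cost c e ∈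
      steinerCosts c (f 0) X := by
    refine ⟨univ.image f, T.map φ, ?_, ?_, ?_, Finset.sum_congr (by ext; simp) fun _ _ => rfl⟩
    · exact Finset.insert_subset (Finset.mem_image_of_mem f (Finset.mem_univ 0)) hX
    · intro e he v hv
      obtain ⟨i, rfl⟩ := hedge e he
      rcases Sym2.mem_iff.mp hv with rfl | rfl <;>
        exact Finset.mem_image_of_mem f (Finset.mem_univ _)
    · have hW : ((univ.image f : Finset V) : Set V) = Set.range (Embedding.map φ T) := by
        rw [Finset.coe_image, Finset.coe_univ, Set.image_univ]
        rfl
      rw [hW]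
      exact (Embedding.map φ T).isoInduceRange.isTree_iff.mp htree
  have hbdd : BddBelow (steinerCosts c (f 0) X) := by
    refine ⟨0, ?_⟩
    rintro y ⟨W, T', -, -, -, rfl⟩
    exact Finset.sum_nonneg fun e _ => sym2Cost_nonneg hc e
  refine (csInf_le hbdd hmem).trans ?_
  have hinj : Function.Injective fun i : Fin m => s(f i.castSucc, f i.succ) := by
    intro i j hij
    rcases Sym2.eq_iff.mp hij with ⟨h, -⟩ | ⟨h1, h2⟩
    · exact Fin.castSucc_injective m (hf h)
    · have h1 := congrArg Fin.val (hf h1)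
      have h2 := congrArg Fin.val (hf h2)
      simp only [Fin.val_castSucc, Fin.val_succ] at h1 h2
      omega
  calc ∑ e ∈ univ.filter (fun e : Sym2 V => e ∈ (T.map φ).edgeSet), sym2Cost c e
      ≤ ∑ e ∈ univ.image fun i : Fin m => s(f i.castSucc, f i.succ), sym2Cost c e := by
        refine Finset.sum_le_sum_of_subset_of_nonneg (fun e he => ?_)
          fun e _ _ => sym2Cost_nonneg hc e
        obtain ⟨i, hi⟩ := hedge e (Finset.mem_filter.mp he).2
        exact Finset.mem_image.mpr ⟨i, Finset.mem_univ i, hi⟩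
    _ = ∑ i : Fin m, c (f i.castSucc) (f i.succ) := by
        rw [Finset.sum_image fun i _ j _ h => hinj h]
        exact Finset.sum_congr rfl fun i _ => sym2Cost_mk hc _ _

theorem optST_rootDist_le {G : SimpleGraph V} {r : V} {k L : ℕ} (hL : 0 < L)
    {u : Fin (k + 1) → V} (hu : IsPathFun G u) (hr : ∀ i, u i ≠ r) :
    optST (rootDist G r L) r (univ.image u) ≤ L + k := by
  have hc := rootDist_isMetric G r hL
  have hf : Function.Injective (Fin.cons r u : Fin (k + 1 + 1) → V) :=
    Fin.cons_injective_iff.mpr ⟨fun ⟨i, hi⟩ => hr i hi, hu.injective⟩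
  have h := optST_le_of_path hc hf (X := univ.image u) (by
    intro x hx
    obtain ⟨i, -, rfl⟩ := Finset.mem_image.mp hx
    exact Finset.mem_image.mpr ⟨i.succ, Finset.mem_univ _, by simp⟩)
  rw [Fin.cons_zero, Fin.sum_univ_succ] at h
  refine h.trans (add_le_add ?_ ?_)
  · simp only [Fin.castSucc_zero, Fin.cons_zero, Fin.cons_succ]
    rw [hc.symm, rootDist_root L (hr 0)]
  · calc _ ≤ ∑ _i : Fin k, (1 : ℝ) := by
          refine Finset.sum_le_sum fun i _ => ?_
          rw [← Fin.succ_castSucc, Fin.cons_succ, Fin.cons_succ]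
          simpa using rootDist_le_length L (hr _) (hr _) (hu.adj i).toWalk
      _ = k := by simp

end Steiner

section Probability

variable {A : Type*}

theorem pr_mono (D : FinDist A) {p q : A → Prop} (h : ∀ a, p a → q a) : D.pr p ≤ D.pr q :=
  Finset.sum_le_sum_of_subset_of_nonneg
    (Finset.monotone_filter_right _ fun a _ => h a) fun a _ _ => D.nonneg a

/-- If every outcome is bad for at most a `β`-fraction of `W`, then some element of `W` is bad
with probability at most `β`. -/
theorem exists_pr_le {ι : Type*} (D : FinDist A) {W : Finset ι} (hW : W.Nonempty)
    (B : A → ι → Prop) {β : ℝ} (hB : ∀ a, ((W.filter (B a)).card : ℝ) ≤ β * W.card) :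
    ∃ u ∈ W, D.pr (fun a => B a u) ≤ β := by
  refine Finset.exists_le_of_sum_le hW ?_
  calc ∑ u ∈ W, D.pr (fun a => B a u)
      = ∑ a ∈ D.support, D.w a * (W.filter (B a)).card := by
        simp only [FinDist.pr, Finset.sum_filter]
        rw [Finset.sum_comm]
        refine Finset.sum_congr rfl fun a _ => ?_
        rw [← Finset.sum_filter, Finset.sum_const, nsmul_eq_mul, mul_comm]
    _ ≤ ∑ a ∈ D.support, D.w a * (β * W.card) :=
        Finset.sum_le_sum fun a _ => mul_le_mul_of_nonneg_left (hB a) (D.nonneg a)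
    _ = ∑ _u ∈ W, β := by
        rw [← Finset.sum_mul, FinDist.support, D.total, Finset.sum_const, nsmul_eq_mul]
        ring

end Probability

section Main

theorem card_filter_leavingIndices_le {V : Type*} [Fintype V] {G : SimpleGraph V} {q : ℕ}
    (hq : 0 < q) (hdeg : ∀ v, (nbrs G v).card ≤ q ^ 4) (a : V → V) (k : ℕ) :
    (univ.filter fun u : Fin (k + 1) → V => IsPathFun G u ∧
      2 * (leavingIndices u a).card < k + 1).card * q ^ k ≤
        2 * (Fintype.card V * (2 * q ^ 4) ^ k) := by
  refine (Nat.mul_le_mul_right _ (Finset.card_le_card ?_)).trans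
    (card_filter_follow_le hq hdeg a k)
  intro u hu
  rw [Finset.mem_filter] at hu ⊢
  have := le_card_leavingIndices u a
  exact ⟨hu.1, hu.2.1, by omega⟩

theorem exists_graph_many_pathFuns (V : Type*) [Fintype V] (r : V) {q L : ℕ} (hq : 2 ≤ q)
    (hL : 0 < L) (hV : 4 * (q ^ 4 + 1) ^ (5 * L) ≤ Fintype.card V) :
    ∃ (G : SimpleGraph V) (W : Finset (Fin (L + 1) → V)), UniqueShortPaths G (2 * L) ∧
      (∀ v, (nbrs G v).card ≤ q ^ 4) ∧ (∀ u ∈ W, IsPathFun G u ∧ ∀ i, u i ≠ r) ∧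
      Fintype.card V * (q ^ 4) ^ L ≤ 2 ^ (L + 1) * W.card := by
  obtain ⟨G, hG, hdeg, hdef⟩ :=
    exists_almost_regular_noShortCycle V (q ^ 4) (g := 2 * (2 * L)) (by omega)
  have hU := hG.uniqueShortPaths
  let S := insert r (univ.filter fun v => (nbrs G v).card < q ^ 4)
  refine ⟨G, pathFuns G (ball G S L) L, hU, hdeg, fun u hu => ⟨(mem_pathFuns.mp hu).1,
    fun i hi => notMem_of_mem_pathFuns le_rfl hu i (hi ▸ Finset.mem_insert_self _ _)⟩, ?_⟩
  have hS : S.card ≤ 2 * (q ^ 4 + 1) ^ (4 * L) := by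
    have h1 := Finset.card_insert_le r (univ.filter fun v => (nbrs G v).card < q ^ 4)
    have h2 : 1 ≤ (q ^ 4 + 1) ^ (4 * L) := Nat.one_le_pow _ _ (by omega)
    rw [show 2 * (2 * L) = 4 * L by ring] at hdef
    change S.card ≤ _ at h1
    omega
  have hball : 2 * (ball G S L).card ≤ Fintype.card V := by
    have h1 : (ball G S L).card ≤ 2 * (q ^ 4 + 1) ^ (4 * L) * (q ^ 4 + 1) ^ L :=
      (card_ball_le hdeg S L).trans (Nat.mul_le_mul_right _ hS)
    rw [mul_assoc, ← pow_add, show 4 * L + L = 5 * L by ring] at h1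
    omega
  have hpath := card_pathFuns (S := S) (d := q ^ 4) (t := L) (k := L) hU (by omega) (by omega)
    (fun v hv => not_lt.mp fun h => hv (Finset.mem_insert_of_mem
      (Finset.mem_filter.mpr ⟨Finset.mem_univ v, h⟩))) le_rfl
  have hcompl : Fintype.card V ≤ 2 * (univ \ ball G S L).card := by
    rw [Finset.card_univ_sdiff]
    omega
  have hq4 : q ^ 4 ≤ 2 * (q ^ 4 - 1) := by
    have : 2 ^ 4 ≤ q ^ 4 := Nat.pow_le_pow_left hq 4
    omega
  calc Fintype.card V * (q ^ 4) ^ L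
      ≤ (2 * (univ \ ball G S L).card) * (2 * (q ^ 4 - 1)) ^ L :=
        Nat.mul_le_mul hcompl (Nat.pow_le_pow_left hq4 L)
    _ = 2 ^ (L + 1) * ((univ \ ball G S L).card * (q ^ 4 - 1) ^ L) := by
        rw [mul_pow]
        ring
    _ ≤ _ := Nat.mul_le_mul_left _ hpath

theorem exists_metric_forall_dist (V : Type*) [Fintype V] [DecidableEq V] (r : V) {q L : ℕ}
    (hq : 2 ≤ q) (hL : 0 < L) (hV : 4 * (q ^ 4 + 1) ^ (5 * L) ≤ Fintype.card V) :
    ∃ c : V → V → ℝ, IsMetric c ∧ ∀ D : FinDist (PathSystem V r), ∃ X : Finset V,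
      X.card = L + 1 ∧ optST c r X ≤ 2 * L ∧
      D.pr (fun P => pathSystemCost c P X < L * (L + 1) / 4) ≤ 4 * (4 / q) ^ L := by
  obtain ⟨G, W, hU, hdeg, hW, hcard⟩ := exists_graph_many_pathFuns V r hq hL hV
  refine ⟨rootDist G r L, rootDist_isMetric G r hL, fun D => ?_⟩
  have hWne : W.Nonempty := by
    rw [← Finset.card_pos]
    have h1 : 0 < Fintype.card V := Fintype.card_pos_iff.mpr ⟨r⟩
    have h2 : 0 < Fintype.card V * (q ^ 4) ^ L := by positivity
    exact Nat.pos_of_mul_pos_left (h2.trans_le hcard)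
  have hbad : ∀ P : PathSystem V r, ((W.filter fun u =>
      pathSystemCost (rootDist G r L) P (univ.image u) < L * (L + 1) / 4).card : ℝ) ≤
        4 * (4 / q) ^ L * W.card := by
    intro P
    obtain ⟨a, ha⟩ := exists_direction hL hU le_rfl P
    have hle := card_filter_leavingIndices_le (by omega) hdeg a L
    have hsub : (W.filter fun u => pathSystemCost (rootDist G r L) P (univ.image u) <
        L * (L + 1) / 4) ⊆ univ.filter fun u : Fin (L + 1) → V => IsPathFun G u ∧
          2 * (leavingIndices u a).card < L + 1 := by
      intro u hu
      rw [Finset.mem_filter] at hu ⊢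
      obtain ⟨huW, hcost⟩ := hu
      obtain ⟨hu, hr⟩ := hW u huW
      refine ⟨Finset.mem_univ u, hu, ?_⟩
      have h1 := ha u hu hr
      have hL' : (0 : ℝ) < L := by exact_mod_cast hL
      have : (2 * (leavingIndices u a).card : ℝ) < L + 1 := by
        refine lt_of_mul_lt_mul_right ?_ hL'.le
        linarith
      exact_mod_cast this
    have hq0 : (0 : ℝ) < q := by exact_mod_cast (by omega : 0 < q)
    have hnat : (W.filter fun u => pathSystemCost (rootDist G r L) P (univ.image u) <
        L * (L + 1) / 4).card * q ^ L ≤ 4 * 4 ^ L * W.card := by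
      refine (Nat.mul_le_mul_right _ (Finset.card_le_card hsub)).trans (hle.trans ?_)
      calc 2 * (Fintype.card V * (2 * q ^ 4) ^ L)
          = 2 * 2 ^ L * (Fintype.card V * (q ^ 4) ^ L) := by rw [mul_pow]; ring
        _ ≤ 2 * 2 ^ L * (2 ^ (L + 1) * W.card) := Nat.mul_le_mul_left _ hcard
        _ = 4 * 4 ^ L * W.card := by
            rw [show 4 ^ L = 2 ^ L * 2 ^ L by rw [← mul_pow]; norm_num]
            ring
    rw [div_pow, mul_div_assoc', div_mul_eq_mul_div, le_div_iff₀ (by positivity)]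
    exact_mod_cast hnat
  obtain ⟨u, huW, hpr⟩ := exists_pr_le D hWne (fun P u =>
    pathSystemCost (rootDist G r L) P (univ.image u) < L * (L + 1) / 4) hbad
  obtain ⟨hu, hr⟩ := hW u huW
  refine ⟨univ.image u, ?_, ?_, hpr⟩
  · rw [Finset.card_image_of_injective _ hu.injective, Finset.card_univ, Fintype.card_fin]
  · exact (optST_rootDist_le hL hu hr).trans (by linarith)

end Main

theorem four_le_exp_two : (4 : ℝ) ≤ Real.exp 2 := by
  have h := Real.add_one_le_exp (1 : ℝ)
  calc (4 : ℝ) ≤ Real.exp 1 * Real.exp 1 := by nlinarith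
    _ = Real.exp 2 := by rw [← Real.exp_add]; norm_num

theorem exists_degree {A : ℝ} (hA : 1 ≤ A) : ∃ q : ℕ, 2 ≤ q ∧ Real.exp (8 * A) ≤ q ∧
    ((q ^ 4 + 1 : ℕ) : ℝ) ≤ Real.exp (40 * A) := by
  have two_le : 2 ≤ Real.exp A := by linarith [Real.add_one_le_exp A]
  have hle : Real.exp (8 * A) ≤ ⌈Real.exp (8 * A)⌉₊ := Nat.le_ceil _
  have h8 : 9 ≤ Real.exp (8 * A) := by linarith [Real.add_one_le_exp (8 * A)]
  refine ⟨⌈Real.exp (8 * A)⌉₊, ?_, hle, ?_⟩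
  · have : (2 : ℝ) ≤ (⌈Real.exp (8 * A)⌉₊ : ℝ) := by linarith
    exact_mod_cast this
  · have hub : (⌈Real.exp (8 * A)⌉₊ : ℝ) ≤ Real.exp (9 * A) := by
      have h1 := (Nat.ceil_lt_add_one (Real.exp_pos (8 * A)).le).le
      rw [show 9 * A = 8 * A + A by ring, Real.exp_add]
      nlinarith
    have h4 : (⌈Real.exp (8 * A)⌉₊ : ℝ) ^ 4 ≤ Real.exp (36 * A) := by
      refine (pow_le_pow_left₀ (Nat.cast_nonneg _) hub 4).trans_eq ?_
      rw [← Real.exp_nat_mul]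
      congr 1
      push_cast
      ring
    have h36 : 1 ≤ Real.exp (36 * A) := Real.one_le_exp (by linarith)
    push_cast
    calc (⌈Real.exp (8 * A)⌉₊ : ℝ) ^ 4 + 1 ≤ Real.exp (36 * A) * Real.exp A := by nlinarith
      _ = Real.exp (37 * A) := by rw [← Real.exp_add]; congr 1; ring
      _ ≤ Real.exp (40 * A) := Real.exp_le_exp.mpr (by linarith)

end UniversalSteiner

/-- There exist constants `c0, C0 > 0` such that for every `ε > 0` and every sufficiently
large `n`, there is a metric space on `n` points with a root such that for every
distribution `D` over collections of vertex-to-root paths there is a terminal set `X`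
with `|X| ≤ C0·log n` and
`Pr_{P←D}[c(P[X]) ≤ c0·(log n/(1+ε))·opt_ST(X)] ≤ (1/2)·exp(−ε·|X|)`. -/
theorem universal_steiner_strong_lower_bound :
    ∃ c0 > (0 : ℝ), ∃ C0 > (0 : ℝ), ∀ ε > (0 : ℝ), ∃ N : ℕ, ∀ n ≥ N,
      ∃ (c : Fin n → Fin n → ℝ) (r : Fin n), IsMetric c ∧
        ∀ D : FinDist (PathSystem (Fin n) r),
          ∃ X : Finset (Fin n),
            (X.card : ℝ) ≤ C0 * Real.log n ∧
            D.pr (fun P =>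
                pathSystemCost c P X ≤ c0 * (Real.log n / (1 + ε)) * optST c r X)
              ≤ (1 / 2) * Real.exp (-ε * X.card) := by
  refine ⟨1 / 5000, by norm_num, 1, one_pos, fun ε hε => ?_⟩
  obtain ⟨A, hA⟩ : ∃ A, A = 1 + ε := ⟨_, rfl⟩
  have hA1 : 1 ≤ A := by linarith
  obtain ⟨q, hq2, hq, hq4⟩ := UniversalSteiner.exists_degree hA1
  refine ⟨⌈Real.exp (320 * A)⌉₊, fun n hn => ?_⟩
  have hn' : Real.exp (320 * A) ≤ n := Nat.ceil_le.mp hn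
  have hn0 : (0 : ℝ) < n := (Real.exp_pos _).trans_le hn'
  have hlog : 320 * A ≤ Real.log n := (Real.le_log_iff_exp_le hn0).mpr hn'
  obtain ⟨L, hL⟩ : ∃ L, L = ⌊Real.log n / (320 * A)⌋₊ := ⟨_, rfl⟩
  have hL0 : 0 < L := by
    rw [hL, Nat.floor_pos, le_div_iff₀ (by linarith)]
    linarith
  have hL1 : (1 : ℝ) ≤ L := by exact_mod_cast hL0
  have hLle : L * (320 * A) ≤ Real.log n := by
    rw [← le_div_iff₀ (by linarith), hL]
    exact Nat.floor_le (div_nonneg (by linarith) (by linarith))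
  have hLlt : Real.log n < (L + 1) * (320 * A) := by
    rw [← div_lt_iff₀ (by linarith), hL]
    exact Nat.lt_floor_add_one _
  have hAL : A ≤ A * L := le_mul_of_one_le_right (by linarith) hL1
  have hLA : (L : ℝ) ≤ A * L := le_mul_of_one_le_left (by linarith) hA1
  have hcard : 4 * (q ^ 4 + 1) ^ (5 * L) ≤ Fintype.card (Fin n) := by
    rw [Fintype.card_fin]
    have : (4 : ℝ) * ((q ^ 4 + 1 : ℕ) : ℝ) ^ (5 * L) ≤ n := by
      calc (4 : ℝ) * ((q ^ 4 + 1 : ℕ) : ℝ) ^ (5 * L)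
          ≤ Real.exp 2 * Real.exp (40 * A) ^ (5 * L) :=
            mul_le_mul UniversalSteiner.four_le_exp_two
              (pow_le_pow_left₀ (Nat.cast_nonneg _) hq4 _) (by positivity) (Real.exp_pos _).le
        _ = Real.exp (2 + 200 * (A * L)) := by
            rw [← Real.exp_nat_mul, ← Real.exp_add]
            congr 1
            push_cast
            ring
        _ ≤ Real.exp (Real.log n) := Real.exp_le_exp.mpr (by linarith)
        _ = n := Real.exp_log hn0
    exact_mod_cast this
  obtain ⟨c, hc, hD⟩ := UniversalSteiner.exists_metric_forall_dist (Fin n)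
    ⟨0, by exact_mod_cast hn0⟩ hq2 hL0 hcard
  refine ⟨c, ⟨0, by exact_mod_cast hn0⟩, hc, fun D => ?_⟩
  obtain ⟨X, hX, hopt, hpr⟩ := hD D
  refine ⟨X, ?_, (UniversalSteiner.pr_mono D fun P hP => ?_).trans (hpr.trans ?_)⟩
  · rw [hX]
    push_cast
    linarith
  · refine hP.trans_lt ?_
    have hA0 : (0 : ℝ) < A := by linarith
    have hquot : Real.log n / A < (L + 1) * 320 := by
      rw [div_lt_iff₀ hA0]
      linarith
    have hquot0 : 0 ≤ Real.log n / A := div_nonneg (by linarith) hA0.le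
    rw [← hA]
    calc 1 / 5000 * (Real.log n / A) * optST c _ X
        ≤ 1 / 5000 * (Real.log n / A) * (2 * L) :=
          mul_le_mul_of_nonneg_left hopt (by positivity)
      _ ≤ 1 / 5000 * ((L + 1) * 320) * (2 * L) := by gcongr
      _ < L * (L + 1) / 4 := by nlinarith
  · have hq0 : (0 : ℝ) < q := (Real.exp_pos _).trans_le hq
    have hbase : 4 / (q : ℝ) ≤ Real.exp (2 - 8 * A) := by
      rw [Real.exp_sub]
      exact div_le_div₀ (Real.exp_pos _).le UniversalSteiner.four_le_exp_two (Real.exp_pos _) hq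
    have h8 : (8 : ℝ) ≤ Real.exp 4 := by
      have h := UniversalSteiner.four_le_exp_two
      rw [show (4 : ℝ) = 2 + 2 by norm_num, Real.exp_add]
      nlinarith
    calc 4 * (4 / (q : ℝ)) ^ L ≤ 1 / 2 * Real.exp 4 * Real.exp (2 - 8 * A) ^ L :=
          mul_le_mul (by linarith) (pow_le_pow_left₀ (by positivity) hbase L) (by positivity)
            (by positivity)
      _ = 1 / 2 * Real.exp (4 + 2 * L - 8 * (A * L)) := by
          rw [mul_assoc, ← Real.exp_nat_mul, ← Real.exp_add]
          congr 2
          ring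
      _ ≤ 1 / 2 * Real.exp (-ε * X.card) := by
          refine mul_le_mul_of_nonneg_left (Real.exp_le_exp.mpr ?_) (by norm_num)
          rw [hX, show ε = A - 1 by linarith]
          push_cast
          nlinarith
end

section
/- There exists a universal constant c > 0 and a constant d₀ such that for every (n,d,β)-expander G with d ≥ d₀ and β ≤ 2/√d, every subset B ⊆ V with |B| ≤ 2n/√d, and every t ≥ 1, the probability that a t-step random walk (u₀,…,u_t) on G has more than t/16 indices i with u_i ∈ B is at most d^{−c·t}. -/
open scoped Classical

open Finset

/-- A symmetric kernel whose quadratic form is bounded by `c` contracts `ℓ²` norms by `c`. -/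
theorem sum_sq_apply_le_of_abs_quadraticForm_le {V : Type*} [Fintype V] (S : V → V → ℝ)
    (hS : ∀ v w, S v w = S w v) {c : ℝ} (hc : 0 < c)
    (h : ∀ x : V → ℝ, |∑ v, ∑ w, S v w * (x v * x w)| ≤ c * ∑ v, x v ^ 2) (x : V → ℝ) :
    ∑ v, (∑ w, S v w * x w) ^ 2 ≤ c ^ 2 * ∑ v, x v ^ 2 := by
  set y : V → ℝ := fun v => ∑ w, S v w * x w
  have hpolar : (∑ v, ∑ w, S v w * ((y v + c * x v) * (y w + c * x w)))
      - ∑ v, ∑ w, S v w * ((y v - c * x v) * (y w - c * x w)) = 4 * c * ∑ v, y v ^ 2 := by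
    have hright : ∑ v, ∑ w, S v w * (y v * x w) = ∑ v, y v ^ 2 := by
      refine sum_congr rfl fun v _ => ?_
      rw [sq, show y v * y v = y v * ∑ w, S v w * x w from rfl, mul_sum]
      refine sum_congr rfl fun w _ => ?_
      ring
    have hleft : ∑ v, ∑ w, S v w * (x v * y w) = ∑ v, y v ^ 2 := by
      rw [← hright, sum_comm]
      refine sum_congr rfl fun v _ => sum_congr rfl fun w _ => ?_
      rw [hS w v]
      ring
    calc _ = 2 * c * ((∑ v, ∑ w, S v w * (y v * x w)) + ∑ v, ∑ w, S v w * (x v * y w)) := by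
          simp only [← sum_sub_distrib, ← sum_add_distrib, mul_sum]
          refine sum_congr rfl fun v _ => sum_congr rfl fun w _ => ?_
          ring
      _ = _ := by rw [hright, hleft]; ring
  have hplus := (le_abs_self _).trans (h fun v => y v + c * x v)
  have hminus := (neg_le_abs _).trans (h fun v => y v - c * x v)
  have hparallelogram : (∑ v, (y v + c * x v) ^ 2) + ∑ v, (y v - c * x v) ^ 2
      = 2 * (∑ v, y v ^ 2) + 2 * c ^ 2 * ∑ v, x v ^ 2 := by
    simp only [← sum_add_distrib, mul_sum]
    refine sum_congr rfl fun v _ => ?_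
    ring
  have hmul : c * (4 * ∑ v, y v ^ 2)
      ≤ c * (2 * (∑ v, y v ^ 2) + 2 * c ^ 2 * ∑ v, x v ^ 2) := by
    rw [← hparallelogram]
    linarith
  linarith [le_of_mul_le_mul_left hmul hc]

/-- The expander mixing bound for the quadratic form of the adjacency matrix at an
arbitrary vector. -/
theorem IsExpander.abs_quadraticForm_le {n d : ℕ} {β γ : ℝ} {G : SimpleGraph (Fin n)}
    (hG : IsExpander n d β G) (hβγ : β ≤ γ) (hγ : 0 ≤ γ) (x : Fin n → ℝ) :
    |∑ v, ∑ w, (if G.Adj v w then 1 else 0) * (x v * x w)|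
      ≤ d * (∑ v, x v) ^ 2 / n + γ * d * ∑ v, x v ^ 2 := by
  obtain rfl | hn := Nat.eq_zero_or_pos n
  · simp
  have hn' : (n : ℝ) ≠ 0 := by positivity
  set a : Fin n → Fin n → ℝ := fun v w => if G.Adj v w then 1 else 0 with ha
  have hrow : ∀ v, ∑ w, a v w = d := fun v => by
    rw [← hG.1 v]
    simp [ha]
  have hsymm : ∀ v w, a v w = a w v := fun v w => by simp [ha, G.adj_comm v w]
  set μ : ℝ := (∑ v, x v) / n with hμ
  have hsum : ∑ v, x v = n * μ := by rw [hμ]; field_simp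
  have hzero : ∑ v, (x v - μ) = 0 := by
    simp [sum_sub_distrib, hsum]
  have hcentered := hG.2 (fun v => x v - μ) hzero
  have hcross : ∑ v, ∑ w, a v w * x v = d * (n * μ) := by
    rw [← hsum, mul_sum]
    refine sum_congr rfl fun v _ => ?_
    rw [← sum_mul, hrow]
  have hcross' : ∑ v, ∑ w, a v w * x w = d * (n * μ) := by
    rw [← hcross, sum_comm]
    refine sum_congr rfl fun v _ => sum_congr rfl fun w _ => ?_
    rw [hsymm]
  have htotal : ∑ v, ∑ w, a v w = n * d := by simp [hrow]
  have hdecomp : ∑ v, ∑ w, a v w * (x v * x w)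
      = d * (n * μ ^ 2)
        + ∑ v, ∑ w, (if G.Adj v w then (x v - μ) * (x w - μ) else 0) := by
    have hexpand : ∑ v, ∑ w, (if G.Adj v w then (x v - μ) * (x w - μ) else 0)
        = (∑ v, ∑ w, a v w * (x v * x w)) - μ * (∑ v, ∑ w, a v w * x v)
          - μ * (∑ v, ∑ w, a v w * x w) + μ ^ 2 * ∑ v, ∑ w, a v w := by
      simp only [mul_sum, ← sum_sub_distrib, ← sum_add_distrib]
      refine sum_congr rfl fun v _ => sum_congr rfl fun w _ => ?_
      simp only [ha]
      split_ifs <;> ring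
    rw [hexpand, hcross, hcross', htotal]
    ring
  have hvariance : ∑ v, (x v - μ) ^ 2 = (∑ v, x v ^ 2) - n * μ ^ 2 := by
    have : ∑ v, (x v - μ) ^ 2 = (∑ v, x v ^ 2) - 2 * μ * (∑ v, x v) + ∑ _v : Fin n, μ ^ 2 := by
      simp only [mul_sum, ← sum_sub_distrib, ← sum_add_distrib]
      refine sum_congr rfl fun v _ => ?_
      ring
    rw [this, hsum]
    simp
    ring
  have hbound : β * d * ∑ v, (x v - μ) ^ 2 ≤ γ * d * ∑ v, x v ^ 2 := by
    have hle : ∑ v, (x v - μ) ^ 2 ≤ ∑ v, x v ^ 2 := by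
      rw [hvariance]
      have : 0 ≤ (n : ℝ) * μ ^ 2 := by positivity
      linarith
    have hnonneg : 0 ≤ ∑ v, (x v - μ) ^ 2 := sum_nonneg fun v _ => sq_nonneg _
    gcongr
  have hmean : (d : ℝ) * (∑ v, x v) ^ 2 / n = d * (n * μ ^ 2) := by
    rw [hsum]; field_simp
  rw [hdecomp, hmean]
  refine (abs_add_le _ _).trans ?_
  rw [abs_of_nonneg (by positivity : (0 : ℝ) ≤ d * (n * μ ^ 2))]
  linarith

/-- The quadratic form of an adjacency matrix conjugated by the square root of a vertex
weight. -/
theorem IsExpander.abs_weighted_quadraticForm_le {n d : ℕ} {β γ s K : ℝ}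
    {G : SimpleGraph (Fin n)} (hG : IsExpander n d β G) (hβγ : β ≤ γ) (hγ : 0 ≤ γ)
    {m : Fin n → ℝ} (hm : ∀ v, 0 ≤ m v) (hms : ∀ v, m v ≤ s) (hK : 0 ≤ K)
    (hmK : ∑ v, m v ≤ K * n) (x : Fin n → ℝ) :
    |∑ v, ∑ w, (√(m v) * (if G.Adj v w then 1 else 0) * √(m w)) * (x v * x w)|
      ≤ (K + γ * s) * d * ∑ v, x v ^ 2 := by
  have hquad := hG.abs_quadraticForm_le hβγ hγ fun v => √(m v) * x v
  have hcauchy : (∑ v, √(m v) * x v) ^ 2 ≤ (∑ v, m v) * ∑ v, x v ^ 2 := by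
    refine (sum_mul_sq_le_sq_mul_sq _ _ _).trans_eq ?_
    simp [Real.sq_sqrt (hm _)]
  have hsq : ∑ v, (√(m v) * x v) ^ 2 ≤ s * ∑ v, x v ^ 2 := by
    rw [mul_sum]
    refine sum_le_sum fun v _ => ?_
    rw [mul_pow, Real.sq_sqrt (hm v)]
    exact mul_le_mul_of_nonneg_right (hms v) (sq_nonneg _)
  have hX : 0 ≤ ∑ v, x v ^ 2 := sum_nonneg fun v _ => sq_nonneg _
  have hmean : (d : ℝ) * (∑ v, √(m v) * x v) ^ 2 / n ≤ K * d * ∑ v, x v ^ 2 := by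
    refine div_le_of_le_mul₀ (by positivity) (by positivity) ?_
    calc (d : ℝ) * (∑ v, √(m v) * x v) ^ 2 ≤ d * ((K * n) * ∑ v, x v ^ 2) := by
          gcongr
          exact hcauchy.trans (by gcongr)
      _ = _ := by ring
  have hrest : γ * d * ∑ v, (√(m v) * x v) ^ 2 ≤ γ * d * (s * ∑ v, x v ^ 2) := by gcongr
  calc _ = |∑ v, ∑ w, (if G.Adj v w then 1 else 0) * ((√(m v) * x v) * (√(m w) * x w))| := by
        congr 1
        refine sum_congr rfl fun v _ => sum_congr rfl fun w _ => ?_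
        ring
    _ ≤ _ := by linarith

/-- The weight of the vertex sequence `u`: the product of the kernel `a` over its steps and
of the vertex weights `m` over its entries. -/
noncomputable def walkWeight {V : Type*} (a : V → V → ℝ) (m : V → ℝ) {t : ℕ}
    (u : Fin (t + 1) → V) : ℝ :=
  (∏ i : Fin t, a (u i.castSucc) (u i.succ)) * ∏ i, m (u i)

theorem walkWeight_cons_cons {V : Type*} (a : V → V → ℝ) (m : V → ℝ) {t : ℕ} (v w : V)
    (u : Fin t → V) :
    walkWeight a m (Fin.cons v (Fin.cons w u : Fin (t + 1) → V) : Fin (t + 2) → V)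
      = m v * a v w * walkWeight a m (Fin.cons w u : Fin (t + 1) → V) := by
  unfold walkWeight
  rw [Fin.prod_univ_succ, Fin.prod_univ_succ (n := t + 1)]
  simp only [Fin.castSucc_zero, Fin.cons_zero, Fin.cons_succ, ← Fin.succ_castSucc]
  ring

theorem sum_pi_fin_succ {V : Type*} [Fintype V] {t : ℕ} (f : (Fin (t + 1) → V) → ℝ) :
    ∑ u, f u = ∑ v, ∑ u : Fin t → V, f (Fin.cons v u) := by
  rw [← (Fin.consEquiv fun _ : Fin (t + 1) => V).sum_comp, Fintype.sum_prod_type]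
  rfl

/-- The total weight of all walks from a vertex, written through iterates of the
symmetrized weighted kernel. -/
theorem sum_walkWeight_cons {V : Type*} [Fintype V] (a : V → V → ℝ) {m : V → ℝ}
    (hm : ∀ v, 0 ≤ m v) (t : ℕ) (v : V) :
    ∑ u : Fin t → V, walkWeight a m (Fin.cons v u : Fin (t + 1) → V)
      = √(m v) * (fun g v => ∑ w, (√(m v) * a v w * √(m w)) * g w)^[t] (fun v => √(m v)) v := by
  induction t generalizing v with
  | zero => simp [walkWeight, Real.mul_self_sqrt (hm v)]
  | succ t ih =>
    rw [sum_pi_fin_succ, Function.iterate_succ_apply', mul_sum]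
    refine sum_congr rfl fun w _ => ?_
    simp only [walkWeight_cons_cons]
    rw [← mul_sum, ih w]
    conv_lhs => rw [← Real.mul_self_sqrt (hm v)]
    ring

theorem IsExpander.sum_walkWeight_le {n d : ℕ} {β γ s K : ℝ}
    {G : SimpleGraph (Fin n)} (hG : IsExpander n d β G) (hβγ : β ≤ γ) (hγ : 0 ≤ γ)
    {m : Fin n → ℝ} (hm : ∀ v, 0 ≤ m v) (hms : ∀ v, m v ≤ s) (hs : 0 ≤ s) (hK : 0 < K)
    (hd : 0 < d) (hmK : ∑ v, m v ≤ K * n) (t : ℕ) :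
    ∑ u : Fin (t + 1) → Fin n, walkWeight (fun v w => if G.Adj v w then 1 else 0) m u
      ≤ K * n * ((K + γ * s) * d) ^ t := by
  set a : Fin n → Fin n → ℝ := fun v w => if G.Adj v w then 1 else 0 with ha
  set T : (Fin n → ℝ) → Fin n → ℝ := fun g v => ∑ w, (√(m v) * a v w * √(m w)) * g w with hT
  have hc : 0 < (K + γ * s) * d := by positivity
  have hstep : ∀ g, ∑ v, T g v ^ 2 ≤ ((K + γ * s) * d) ^ 2 * ∑ v, g v ^ 2 :=
    sum_sq_apply_le_of_abs_quadraticForm_le _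
      (fun v w => by simp only [ha, G.adj_comm v w]; ring) hc
      (hG.abs_weighted_quadraticForm_le hβγ hγ hm hms hK.le hmK)
  have hiter : ∀ t, ∑ v, T^[t] (fun v => √(m v)) v ^ 2
      ≤ (((K + γ * s) * d) ^ t) ^ 2 * (K * n) := by
    intro t
    induction t with
    | zero => simpa [Real.sq_sqrt (hm _)] using hmK
    | succ t ih =>
      rw [Function.iterate_succ_apply']
      refine (hstep _).trans ?_
      calc _ ≤ ((K + γ * s) * d) ^ 2 * ((((K + γ * s) * d) ^ t) ^ 2 * (K * n)) := by gcongr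
        _ = _ := by ring
  rw [sum_pi_fin_succ]
  simp only [sum_walkWeight_cons a hm t]
  refine le_of_sq_le_sq ?_ (by positivity)
  refine (sum_mul_sq_le_sq_mul_sq _ _ _).trans ?_
  calc _ ≤ (K * n) * ((((K + γ * s) * d) ^ t) ^ 2 * (K * n)) := by
        refine mul_le_mul ?_ (hiter t) (sum_nonneg fun v _ => sq_nonneg _) (by positivity)
        simpa [Real.sq_sqrt (hm _)] using hmK
    _ = _ := by ring

theorem walkWeight_of_isWalkFun {n t : ℕ} {G : SimpleGraph (Fin n)} {u : Fin (t + 1) → Fin n}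
    (hu : IsWalkFun G u) (B : Finset (Fin n)) (s : ℝ) :
    walkWeight (fun v w => if G.Adj v w then 1 else 0) (fun v => if v ∈ B then s else 1) u
      = s ^ (univ.filter fun i => u i ∈ B).card := by
  unfold walkWeight
  rw [prod_eq_one fun i _ => if_pos (hu i), prod_ite]
  simp

/-- Exponential Markov inequality for the number of visits of a walk to `B`. -/
theorem card_walks_mul_rpow_le {n t : ℕ} (G : SimpleGraph (Fin n)) (B : Finset (Fin n))
    {s r : ℝ} (hs : 1 ≤ s) :
    ((univ.filter fun u : Fin (t + 1) → Fin n => IsWalkFun G u ∧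
        ((univ.filter fun i => u i ∈ B).card : ℝ) > r).card : ℝ) * s ^ r
      ≤ ∑ u : Fin (t + 1) → Fin n,
        walkWeight (fun v w => if G.Adj v w then 1 else 0) (fun v => if v ∈ B then s else 1) u := by
  rw [← nsmul_eq_mul]
  refine (card_nsmul_le_sum _ _ _ fun u hu => ?_).trans
    (sum_le_sum_of_subset_of_nonneg (filter_subset _ _) fun u _ _ => ?_)
  · obtain ⟨hwalk, hmany⟩ := (mem_filter.mp hu).2
    rw [walkWeight_of_isWalkFun hwalk, ← Real.rpow_natCast]
    exact Real.rpow_le_rpow_of_exponent_le hs hmany.le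
  · refine mul_nonneg (prod_nonneg fun i _ => ?_) (prod_nonneg fun i _ => ?_) <;> dsimp only <;>
      split_ifs <;> linarith

/-- There are constants `κ > 0` and `d₀` such that for every `(n,d,β)`-expander with
`d ≥ d₀` and `β ≤ 2/√d`, every vertex subset `B` with `|B| ≤ 2n/√d`, and every `t ≥ 1`,
the probability that a `t`-step random walk `(u₀,…,u_t)` has more than `t/16` indices `i`
with `u_i ∈ B` is at most `d^{−κ·t}`. -/
theorem random_walk_few_bad_vertices :
    ∃ κ > (0 : ℝ), ∃ d₀ : ℕ,
      ∀ (n d : ℕ) (β : ℝ) (G : SimpleGraph (Fin n)),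
        d ≥ d₀ → β ≤ 2 / Real.sqrt d → IsExpander n d β G →
        ∀ B : Finset (Fin n), (B.card : ℝ) ≤ 2 * n / Real.sqrt d →
        ∀ t : ℕ, 1 ≤ t →
          walkPr G d t (fun u =>
              ((Finset.univ.filter (fun i : Fin (t + 1) => u i ∈ B)).card : ℝ)
                > (t : ℝ) / 16)
            ≤ (d : ℝ) ^ (-(κ * t)) := by
  refine ⟨1 / 64, by norm_num, 15 ^ 64, ?_⟩
  intro n d β G hd hβ hG B hB t ht
  have hd1 : 1 ≤ d := le_trans (Nat.one_le_pow _ _ (by norm_num)) hd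
  have hdpos : (0 : ℝ) < d := by exact_mod_cast hd1
  have hs : 1 ≤ √(d : ℝ) := Real.one_le_sqrt.mpr (by exact_mod_cast hd1)
  have hs0 : 0 < √(d : ℝ) := by linarith
  have hsum : ∑ v, (if v ∈ B then √(d : ℝ) else 1) ≤ 3 * n := by
    calc ∑ v, (if v ∈ B then √(d : ℝ) else 1)
        ≤ ∑ v : Fin n, ((if v ∈ B then √(d : ℝ) else 0) + 1) := by
          refine sum_le_sum fun v _ => ?_
          split_ifs <;> linarith
      _ = B.card * √(d : ℝ) + n := by simp [sum_add_distrib]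
      _ ≤ 2 * n / √(d : ℝ) * √(d : ℝ) + n := by gcongr
      _ = 3 * n := by field_simp; ring
  have hweight := hG.sum_walkWeight_le (s := √(d : ℝ)) (K := 3) hβ (by positivity)
    (m := fun v => if v ∈ B then √(d : ℝ) else 1)
    (fun v => by split_ifs <;> linarith)
    (fun v => by split_ifs <;> linarith)
    hs0.le (by norm_num) hd1 hsum t
  rw [div_mul_cancel₀ _ hs0.ne'] at hweight
  have hmarkov := (card_walks_mul_rpow_le (t := t) G B (r := (t : ℝ) / 16) hs).trans hweight
  have hpow : √(d : ℝ) ^ ((t : ℝ) / 16)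
      = (d : ℝ) ^ (1 / 64 * (t : ℝ)) * (d : ℝ) ^ (1 / 64 * (t : ℝ)) := by
    rw [Real.sqrt_eq_rpow, ← Real.rpow_mul hdpos.le, ← Real.rpow_add hdpos]
    ring_nf
  have hbase : (15 : ℝ) ^ t ≤ (d : ℝ) ^ (1 / 64 * (t : ℝ)) := by
    rw [Real.rpow_mul hdpos.le, Real.rpow_natCast]
    gcongr
    rw [one_div]
    refine (Real.le_rpow_inv_iff_of_pos (by norm_num) hdpos.le (by norm_num)).mpr ?_
    have hcast : ((15 ^ 64 : ℕ) : ℝ) ≤ d := by exact_mod_cast hd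
    rw [Nat.cast_pow] at hcast
    exact_mod_cast hcast
  have hconst : (3 : ℝ) * 5 ^ t ≤ 15 ^ t := by
    calc (3 : ℝ) * 5 ^ t ≤ 3 ^ t * 5 ^ t := by
          gcongr
          exact le_self_pow₀ (by norm_num) (by lia)
      _ = 15 ^ t := by rw [← mul_pow]; norm_num
  unfold walkPr
  have hp : 0 < (d : ℝ) ^ (1 / 64 * (t : ℝ)) := Real.rpow_pos_of_pos hdpos _
  refine div_le_of_le_mul₀ (by positivity) (by positivity) ?_
  rw [Real.rpow_neg hdpos.le, inv_mul_eq_div, le_div_iff₀ hp]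
  refine le_of_mul_le_mul_right ?_ hp
  rw [mul_assoc, ← hpow]
  refine hmarkov.trans ?_
  calc 3 * (n : ℝ) * ((3 + 2) * d) ^ t = (3 * 5 ^ t) * (n * d ^ t) := by
        rw [mul_pow]; norm_num; ring
    _ ≤ (d : ℝ) ^ (1 / 64 * (t : ℝ)) * (n * d ^ t) := by
        gcongr
        exact hconst.trans hbase
    _ = _ := by ring
end

section
/- There exist constants c0, C0, ε0 > 0 such that for infinitely many n there is a metric space (V,c) on n points with a root r ∈ V with the following property: for every probability distribution D over permutations σ of V, there exists X ⊆ V with |X| ≤ C0·log n such that Pr_{σ←D}[ c(σ_X) ≤ c0·log n·opt_TSP(X) ] ≤ (1/2)·exp(−ε0·|X|). -/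
open scoped Classical

namespace UniversalTSP

section Gap

variable {m : ℕ} [NeZero m]

/-- The discrete Fourier transform on `ZMod m × ZMod m`. -/
noncomputable def fourier (f : ZMod m × ZMod m → ℝ) (k : ZMod m × ZMod m) : ℂ :=
  ∑ p, (f p : ℂ) * ZMod.stdAddChar (k.1 * p.1 + k.2 * p.2)

theorem sum_stdAddChar_pair (a b : ZMod m) :
    ∑ k : ZMod m × ZMod m, (ZMod.stdAddChar (k.1 * a + k.2 * b) : ℂ) =
      if a = 0 ∧ b = 0 then (m : ℂ) ^ 2 else 0 := by
  have h : ∀ c : ZMod m, ∑ x : ZMod m, (ZMod.stdAddChar (x * c) : ℂ) =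
      if c = 0 then (m : ℂ) else 0 := by
    intro c
    have := AddChar.sum_mulShift (ψ := (ZMod.stdAddChar : AddChar (ZMod m) ℂ)) c
      (ZMod.isPrimitive_stdAddChar m)
    rw [this, ZMod.card]
    split_ifs <;> simp
  simp_rw [AddChar.map_add_eq_mul]
  rw [Fintype.sum_prod_type]
  simp_rw [← Finset.mul_sum, ← Finset.sum_mul, h]
  by_cases ha : a = 0 <;> by_cases hb : b = 0 <;> simp [ha, hb, sq]

theorem sum_normSq_fourier (f : ZMod m × ZMod m → ℝ) :
    ∑ k, Complex.normSq (fourier f k) = (m : ℝ) ^ 2 * ∑ p, f p ^ 2 := by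
  have h : ∀ k, ((Complex.normSq (fourier f k) : ℝ) : ℂ) = ∑ p, ∑ q,
      (f p : ℂ) * f q * ZMod.stdAddChar (k.1 * (p.1 - q.1) + k.2 * (p.2 - q.2)) := by
    intro k
    rw [← Complex.mul_conj, fourier, map_sum, Finset.sum_mul_sum]
    refine Finset.sum_congr rfl fun p _ => Finset.sum_congr rfl fun q _ => ?_
    rw [map_mul, Complex.conj_ofReal, ← AddChar.map_neg_eq_conj]
    have : k.1 * (p.1 - q.1) + k.2 * (p.2 - q.2) =
      (k.1 * p.1 + k.2 * p.2) + -(k.1 * q.1 + k.2 * q.2) := by ring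
    rw [this, AddChar.map_add_eq_mul _ (k.1 * p.1 + k.2 * p.2)]
    ring
  have h2 : ((∑ k, Complex.normSq (fourier f k) : ℝ) : ℂ) =
      (((m : ℝ) ^ 2 * ∑ p, f p ^ 2 : ℝ) : ℂ) := by
    push_cast
    simp_rw [h]
    rw [Finset.sum_comm, Finset.mul_sum]
    refine Finset.sum_congr rfl fun p _ => ?_
    rw [Finset.sum_comm]
    simp_rw [← Finset.mul_sum, sum_stdAddChar_pair, sub_eq_zero]
    rw [Finset.sum_eq_single p]
    · simp; ring
    · intro q _ hq
      rw [if_neg, mul_zero]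
      rintro ⟨h1, h2⟩
      exact hq (Prod.ext h1.symm h2.symm)
    · simp
  exact_mod_cast h2

theorem fourier_sub (f g : ZMod m × ZMod m → ℝ) (k) :
    fourier (fun p => f p - g p) k = fourier f k - fourier g k := by
  simp [fourier, sub_mul, Finset.sum_sub_distrib]

theorem re_stdAddChar_nonpos (x : ZMod m) (hx : (m : ℤ) ≤ 4 * |x.valMinAbs|) :
    (ZMod.stdAddChar x : ℂ).re ≤ 0 := by
  have hm : (0 : ℝ) < m := by exact_mod_cast Nat.pos_of_ne_zero (NeZero.ne m)
  have hup : 2 * |x.valMinAbs| ≤ (m : ℤ) := by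
    have := ZMod.valMinAbs_mem_Ioc x
    rw [Set.mem_Ioc] at this
    rcases abs_cases x.valMinAbs with h | h <;> omega
  have h := ZMod.stdAddChar_coe (N := m) x.valMinAbs
  rw [ZMod.coe_valMinAbs] at h
  rw [h]
  have : (2 * Real.pi * Complex.I * (x.valMinAbs : ℂ) / m) =
    ((2 * Real.pi * x.valMinAbs / m : ℝ) : ℂ) * Complex.I := by push_cast; ring
  rw [this, Complex.exp_ofReal_mul_I_re, ← Real.cos_abs]
  have h4 : (m : ℝ) ≤ 4 * |(x.valMinAbs : ℝ)| := by exact_mod_cast hx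
  have h2 : 2 * |(x.valMinAbs : ℝ)| ≤ (m : ℝ) := by exact_mod_cast hup
  rw [abs_div, abs_mul, abs_mul, abs_of_pos Real.pi_pos, abs_of_pos hm, abs_two]
  apply Real.cos_nonpos_of_pi_div_two_le_of_le
  · rw [le_div_iff₀ hm]; nlinarith [Real.pi_pos]
  · rw [div_le_iff₀ hm]; nlinarith [Real.pi_pos]


/-- Translation by `(1, 0)`. -/
def shiftFst : Equiv.Perm (ZMod m × ZMod m) := Equiv.addRight (1, 0)

/-- Translation by `(0, 1)`. -/
def shiftSnd : Equiv.Perm (ZMod m × ZMod m) := Equiv.addRight (0, 1)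

/-- The shear `(x, y) ↦ (x + y, y)`. -/
def shearFst : Equiv.Perm (ZMod m × ZMod m) where
  toFun p := (p.1 + p.2, p.2)
  invFun p := (p.1 - p.2, p.2)
  left_inv p := by simp
  right_inv p := by simp

/-- The shear `(x, y) ↦ (x, y + x)`. -/
def shearSnd : Equiv.Perm (ZMod m × ZMod m) where
  toFun p := (p.1, p.2 + p.1)
  invFun p := (p.1, p.2 - p.1)
  left_inv p := by simp
  right_inv p := by simp

theorem fourier_comp (f : ZMod m × ZMod m → ℝ) (σ : Equiv.Perm (ZMod m × ZMod m)) (k) :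
    fourier (fun p => f (σ p)) k =
      ∑ p, (f p : ℂ) * ZMod.stdAddChar (k.1 * (σ.symm p).1 + k.2 * (σ.symm p).2) := by
  rw [fourier, ← Equiv.sum_comp σ fun p =>
    (f p : ℂ) * ZMod.stdAddChar (k.1 * (σ.symm p).1 + k.2 * (σ.symm p).2)]
  simp

theorem fourier_shiftFst (f : ZMod m × ZMod m → ℝ) (k) :
    fourier (fun p => f (shiftFst p)) k = ZMod.stdAddChar (-k.1) * fourier f k := by
  rw [fourier_comp, fourier, Finset.mul_sum]
  refine Finset.sum_congr rfl fun p _ => ?_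
  rw [mul_left_comm, ← AddChar.map_add_eq_mul]
  congr 2
  simp [shiftFst]
  ring

theorem fourier_shiftSnd (f : ZMod m × ZMod m → ℝ) (k) :
    fourier (fun p => f (shiftSnd p)) k = ZMod.stdAddChar (-k.2) * fourier f k := by
  rw [fourier_comp, fourier, Finset.mul_sum]
  refine Finset.sum_congr rfl fun p _ => ?_
  rw [mul_left_comm, ← AddChar.map_add_eq_mul]
  congr 2
  simp [shiftSnd]
  ring

theorem fourier_shearFst (f : ZMod m × ZMod m → ℝ) (k) :
    fourier (fun p => f (shearFst p)) k = fourier f (shearSnd.symm k) := by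
  rw [fourier_comp, fourier]
  refine Finset.sum_congr rfl fun p _ => ?_
  congr 2
  simp [shearFst, shearSnd]
  ring

theorem fourier_shearSnd (f : ZMod m × ZMod m → ℝ) (k) :
    fourier (fun p => f (shearSnd p)) k = fourier f (shearFst.symm k) := by
  rw [fourier_comp, fourier]
  refine Finset.sum_congr rfl fun p _ => ?_
  congr 2
  simp [shearFst, shearSnd]
  ring

theorem normSq_sub_le (a b : ℂ) : Complex.normSq a - Complex.normSq b ≤
    8 * Complex.normSq (b - a) + (Complex.normSq a + Complex.normSq b) / 16 := by
  simp only [Complex.normSq_apply, Complex.sub_re, Complex.sub_im]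
  nlinarith [sq_nonneg (16 * (a.re - b.re) - (a.re + b.re)), sq_nonneg (a.re - b.re),
    sq_nonneg (16 * (a.im - b.im) - (a.im + b.im)), sq_nonneg (a.im - b.im)]

/-- The mass of `|φ|²` on a set changes little when the set is moved by a permutation that
almost preserves `φ`. -/
theorem sum_normSq_le_sum_comp {K : Type*} [Fintype K] (φ : K → ℂ)
    (s : Equiv.Perm K) (B : Finset K) :
    ∑ k ∈ B, Complex.normSq (φ k) ≤ ∑ k ∈ B, Complex.normSq (φ (s k)) +
      (8 * ∑ k, Complex.normSq (φ (s k) - φ k) + (∑ k, Complex.normSq (φ k)) / 8) := by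
  have h1 : ∑ k ∈ B, (Complex.normSq (φ k) - Complex.normSq (φ (s k))) ≤
      ∑ k ∈ B, (8 * Complex.normSq (φ (s k) - φ k) +
        (Complex.normSq (φ k) + Complex.normSq (φ (s k))) / 16) :=
    Finset.sum_le_sum fun k _ => normSq_sub_le _ _
  have h2 : ∑ k ∈ B, (8 * Complex.normSq (φ (s k) - φ k) +
        (Complex.normSq (φ k) + Complex.normSq (φ (s k))) / 16) ≤
      ∑ k, (8 * Complex.normSq (φ (s k) - φ k) +
        (Complex.normSq (φ k) + Complex.normSq (φ (s k))) / 16) := by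
    apply Finset.sum_le_univ_sum_of_nonneg
    intro k
    have := Complex.normSq_nonneg (φ (s k) - φ k)
    have := Complex.normSq_nonneg (φ k)
    have := Complex.normSq_nonneg (φ (s k))
    positivity
  have h3 := h1.trans h2
  rw [Finset.sum_sub_distrib, Finset.sum_add_distrib, ← Finset.mul_sum, ← Finset.sum_div,
    Finset.sum_add_distrib, Equiv.sum_comp s (fun k => Complex.normSq (φ k))] at h3
  linarith

/-- If two almost-`φ`-preserving permutations map `Q ∩ D` into disjoint parts of `Q`, then most
of the mass of `|φ|²` on `Q` lies outside `D`. -/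
theorem sum_normSq_le_of_ping_pong {K : Type*} [Fintype K] [DecidableEq K] (φ : K → ℂ)
    (s s' : Equiv.Perm K) (Q D : Finset K)
    (hs : ∀ k ∈ Q ∩ D, s k ∈ Q) (hs' : ∀ k ∈ Q ∩ D, s' k ∈ Q)
    (hd : ∀ k ∈ Q ∩ D, ∀ l ∈ Q ∩ D, s k ≠ s' l) :
    ∑ k ∈ Q, Complex.normSq (φ k) ≤ 2 * ∑ k ∈ Q \ D, Complex.normSq (φ k) +
      8 * ∑ k, Complex.normSq (φ (s k) - φ k) + 8 * ∑ k, Complex.normSq (φ (s' k) - φ k) +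
      (∑ k, Complex.normSq (φ k)) / 4 := by
  have h1 := sum_normSq_le_sum_comp φ s (Q ∩ D)
  have h2 := sum_normSq_le_sum_comp φ s' (Q ∩ D)
  have h3 : ∑ k ∈ Q ∩ D, Complex.normSq (φ (s k)) + ∑ k ∈ Q ∩ D, Complex.normSq (φ (s' k)) ≤
      ∑ k ∈ Q, Complex.normSq (φ k) := by
    have e : ∀ u : Equiv.Perm K, ∑ k ∈ Q ∩ D, Complex.normSq (φ (u k)) =
        ∑ k ∈ (Q ∩ D).map u.toEmbedding, Complex.normSq (φ k) := by
      intro u; rw [Finset.sum_map]; rfl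
    rw [e, e, ← Finset.sum_union]
    · apply Finset.sum_le_sum_of_subset_of_nonneg
      · intro k hk
        simp only [Finset.mem_union, Finset.mem_map] at hk
        rcases hk with ⟨a, ha, rfl⟩ | ⟨a, ha, rfl⟩
        · exact hs a ha
        · exact hs' a ha
      · intros; exact Complex.normSq_nonneg _
    · rw [Finset.disjoint_left]
      intro k hk hk'
      simp only [Finset.mem_map] at hk hk'
      obtain ⟨a, ha, rfl⟩ := hk
      obtain ⟨b, hb, h⟩ := hk'
      exact hd a ha b hb h.symm
  have h4 := Finset.sum_inter_add_sum_sdiff Q D (fun k => Complex.normSq (φ k))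
  linarith

theorem valMinAbs_add_of_lt (x y : ZMod m) (hx : 4 * |x.valMinAbs| < m)
    (hy : 4 * |y.valMinAbs| < m) : (x + y).valMinAbs = x.valMinAbs + y.valMinAbs := by
  rw [ZMod.valMinAbs_spec]
  refine ⟨by simp, ?_⟩
  rw [Set.mem_Ioc]
  rcases abs_cases x.valMinAbs with h | h <;> rcases abs_cases y.valMinAbs with h' | h' <;> omega

theorem valMinAbs_sub_of_lt (x y : ZMod m) (hx : 4 * |x.valMinAbs| < m)
    (hy : 4 * |y.valMinAbs| < m) : (x - y).valMinAbs = x.valMinAbs - y.valMinAbs := by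
  rw [ZMod.valMinAbs_spec]
  refine ⟨by simp, ?_⟩
  rw [Set.mem_Ioc]
  rcases abs_cases x.valMinAbs with h | h <;> rcases abs_cases y.valMinAbs with h' | h' <;> omega

theorem two_mul_le_normSq_stdAddChar_mul_sub (x : ZMod m) (hx : (m : ℤ) ≤ 4 * |x.valMinAbs|)
    (z : ℂ) :
    2 * Complex.normSq z ≤ Complex.normSq (ZMod.stdAddChar (-x) * z - z) := by
  have h1 : (ZMod.stdAddChar (-x) * z - z) = (ZMod.stdAddChar (-x) - 1) * z := by ring
  rw [h1, map_mul]
  apply mul_le_mul_of_nonneg_right _ (Complex.normSq_nonneg z)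
  have h2 := re_stdAddChar_nonpos x hx
  have h3 : Complex.normSq (ZMod.stdAddChar (-x) : ℂ) = 1 := by
    rw [Complex.normSq_eq_norm_sq, AddChar.norm_apply]; simp
  rw [Complex.normSq_sub, h3, AddChar.map_neg_eq_conj]
  simp
  linarith

/-- Spectral gap of the action of the two unit translations and the two shears on
`ZMod m × ZMod m`. -/
theorem sum_sq_le_of_sum_eq_zero (f : ZMod m × ZMod m → ℝ) (hf : ∑ p, f p = 0) :
    ∑ p, f p ^ 2 ≤ 32 * (∑ p, (f (shiftFst p) - f p) ^ 2 + ∑ p, (f (shiftSnd p) - f p) ^ 2 +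
      ∑ p, (f (shearFst p) - f p) ^ 2 + ∑ p, (f (shearSnd p) - f p) ^ 2) := by
  classical
  have hm : (0 : ℝ) < (m : ℝ) ^ 2 := by
    have : (0 : ℝ) < m := by exact_mod_cast Nat.pos_of_ne_zero (NeZero.ne m)
    positivity
  have hN := sum_normSq_fourier f
  have hd1 := sum_normSq_fourier (fun p => f (shiftFst p) - f p)
  have hd2 := sum_normSq_fourier (fun p => f (shiftSnd p) - f p)
  have hd3 := sum_normSq_fourier (fun p => f (shearFst p) - f p)
  have hd4 := sum_normSq_fourier (fun p => f (shearSnd p) - f p)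
  simp_rw [fourier_sub, fourier_shiftFst, fourier_shiftSnd, fourier_shearFst,
    fourier_shearSnd] at hd1 hd2 hd3 hd4
  have h0 : fourier f (0, 0) = 0 := by
    simp only [fourier, zero_mul, add_zero, AddChar.map_zero_eq_one, mul_one]
    exact_mod_cast hf
  set φ := fourier f with hφ
  have hinv : ∀ s : Equiv.Perm (ZMod m × ZMod m), ∑ k, Complex.normSq (φ (s k) - φ k) =
      ∑ k, Complex.normSq (φ (s.symm k) - φ k) := by
    intro s
    rw [← Equiv.sum_comp s.symm]
    refine Finset.sum_congr rfl fun k _ => ?_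
    rw [Equiv.apply_symm_apply, ← Complex.normSq_neg, neg_sub]
  set D : Finset (ZMod m × ZMod m) := Finset.univ.filter fun k =>
    4 * |k.1.valMinAbs| < m ∧ 4 * |k.2.valMinAbs| < m with hD
  set Q : Finset (ZMod m × ZMod m) := Finset.univ.filter fun k =>
    (0 < k.1.valMinAbs ∧ 0 ≤ k.2.valMinAbs) ∨ (k.1.valMinAbs < 0 ∧ k.2.valMinAbs ≤ 0) with hQ
  set R : Finset (ZMod m × ZMod m) := Finset.univ.filter fun k =>
    (0 < k.2.valMinAbs ∧ k.1.valMinAbs ≤ 0) ∨ (k.2.valMinAbs < 0 ∧ 0 ≤ k.1.valMinAbs) with hR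
  have hQle := sum_normSq_le_of_ping_pong φ shearFst shearSnd Q D
    (by
      rintro ⟨a, b⟩ hk
      simp only [hQ, hD, Finset.mem_inter, Finset.mem_filter, Finset.mem_univ, true_and] at hk
      simp only [hQ, shearFst, Finset.mem_filter, Finset.mem_univ, true_and, Equiv.coe_fn_mk]
      rw [valMinAbs_add_of_lt a b hk.2.1 hk.2.2]
      omega)
    (by
      rintro ⟨a, b⟩ hk
      simp only [hQ, hD, Finset.mem_inter, Finset.mem_filter, Finset.mem_univ, true_and] at hk
      simp only [hQ, shearSnd, Finset.mem_filter, Finset.mem_univ, true_and, Equiv.coe_fn_mk]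
      rw [valMinAbs_add_of_lt b a hk.2.2 hk.2.1]
      omega)
    (by
      rintro ⟨a, b⟩ hk ⟨c, d⟩ hl h
      simp only [hQ, hD, Finset.mem_inter, Finset.mem_filter, Finset.mem_univ, true_and] at hk hl
      simp only [shearFst, shearSnd, Equiv.coe_fn_mk, Prod.mk.injEq] at h
      have h1 := valMinAbs_add_of_lt a b hk.2.1 hk.2.2
      have h2 := valMinAbs_add_of_lt d c hl.2.2 hl.2.1
      rw [h.1] at h1
      rw [← h.2] at h2
      omega)
  have hRle := sum_normSq_le_of_ping_pong φ shearFst.symm shearSnd.symm R D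
    (by
      rintro ⟨a, b⟩ hk
      simp only [hR, hD, Finset.mem_inter, Finset.mem_filter, Finset.mem_univ, true_and] at hk
      simp only [hR, shearFst, Finset.mem_filter, Finset.mem_univ, true_and, Equiv.coe_fn_symm_mk]
      rw [valMinAbs_sub_of_lt a b hk.2.1 hk.2.2]
      omega)
    (by
      rintro ⟨a, b⟩ hk
      simp only [hR, hD, Finset.mem_inter, Finset.mem_filter, Finset.mem_univ, true_and] at hk
      simp only [hR, shearSnd, Finset.mem_filter, Finset.mem_univ, true_and, Equiv.coe_fn_symm_mk]
      rw [valMinAbs_sub_of_lt b a hk.2.2 hk.2.1]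
      omega)
    (by
      rintro ⟨a, b⟩ hk ⟨c, d⟩ hl h
      simp only [hR, hD, Finset.mem_inter, Finset.mem_filter, Finset.mem_univ, true_and] at hk hl
      simp only [shearFst, shearSnd, Equiv.coe_fn_symm_mk, Prod.mk.injEq] at h
      have h1 := valMinAbs_sub_of_lt a b hk.2.1 hk.2.2
      have h2 := valMinAbs_sub_of_lt d c hl.2.2 hl.2.1
      rw [h.1] at h1
      rw [← h.2] at h2
      omega)
  rw [hinv shearFst, hinv shearSnd] at hQle
  have hdisj : Disjoint Q R := by
    rw [Finset.disjoint_left]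
    intro k hk hk'
    simp only [hQ, hR, Finset.mem_filter, Finset.mem_univ, true_and] at hk hk'
    omega
  have hsplit : ∑ k, Complex.normSq (φ k) =
      ∑ k ∈ Q, Complex.normSq (φ k) + ∑ k ∈ R, Complex.normSq (φ k) := by
    rw [← Finset.sum_union hdisj]
    symm
    apply Finset.sum_subset (Finset.subset_univ _)
    rintro ⟨a, b⟩ _ hk
    simp only [hQ, hR, Finset.mem_union, Finset.mem_filter, Finset.mem_univ, true_and] at hk
    have ha : a.valMinAbs = 0 := by omega
    have hb : b.valMinAbs = 0 := by omega
    rw [ZMod.valMinAbs_eq_zero] at ha hb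
    rw [ha, hb, h0, map_zero]
  have hout : 2 * (∑ k ∈ Q \ D, Complex.normSq (φ k) + ∑ k ∈ R \ D, Complex.normSq (φ k)) ≤
      ∑ k, Complex.normSq (ZMod.stdAddChar (-k.1) * φ k - φ k) +
        ∑ k, Complex.normSq (ZMod.stdAddChar (-k.2) * φ k - φ k) := by
    rw [← Finset.sum_union (hdisj.mono Finset.sdiff_subset Finset.sdiff_subset), Finset.mul_sum,
      ← Finset.sum_add_distrib]
    refine le_trans (Finset.sum_le_sum fun k hk => ?_)
      (Finset.sum_le_univ_sum_of_nonneg fun k =>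
        add_nonneg (Complex.normSq_nonneg _) (Complex.normSq_nonneg _))
    have hkD : ¬ (4 * |k.1.valMinAbs| < m ∧ 4 * |k.2.valMinAbs| < m) := by
      simp only [hD, Finset.mem_union, Finset.mem_sdiff, Finset.mem_filter, Finset.mem_univ,
        true_and] at hk
      tauto
    have n1 := Complex.normSq_nonneg (ZMod.stdAddChar (-k.1) * φ k - φ k)
    have n2 := Complex.normSq_nonneg (ZMod.stdAddChar (-k.2) * φ k - φ k)
    by_cases h1 : 4 * |k.1.valMinAbs| < (m : ℤ)
    · have := two_mul_le_normSq_stdAddChar_mul_sub k.2 (by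
        by_contra h; exact hkD ⟨h1, not_le.1 h⟩) (φ k)
      linarith
    · have := two_mul_le_normSq_stdAddChar_mul_sub k.1 (not_lt.1 h1) (φ k)
      linarith
  have n1 : 0 ≤ ∑ p, (f (shiftFst p) - f p) ^ 2 := Finset.sum_nonneg fun _ _ => sq_nonneg _
  have n2 : 0 ≤ ∑ p, (f (shiftSnd p) - f p) ^ 2 := Finset.sum_nonneg fun _ _ => sq_nonneg _
  refine le_of_mul_le_mul_left ?_ hm
  rw [← hN]
  nlinarith

end Gap

section Walk

variable {V : Type*}

/-- The vertices visited by the walk that starts at `x` and follows the moves `w 0`, `w 1`, …. -/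
def trajectory (g : Fin 5 → Equiv.Perm V) : (t : ℕ) → V → (Fin t → Fin 5) → List V
  | 0, x, _ => [x]
  | t + 1, x, w => x :: trajectory g t (g (w 0) x) (Fin.tail w)

theorem length_trajectory (g : Fin 5 → Equiv.Perm V) (t : ℕ) (x : V) (w : Fin t → Fin 5) :
    (trajectory g t x w).length = t + 1 := by
  induction t generalizing x with
  | zero => rfl
  | succ t ih => simp [trajectory, ih]

theorem sum_words_succ {t : ℕ} (F : (Fin (t + 1) → Fin 5) → ℝ) :
    ∑ w, F w = ∑ i, ∑ w : Fin t → Fin 5, F (Fin.cons i w) := by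
  rw [← (Fin.consEquiv fun _ => Fin 5).sum_comp, Fintype.sum_prod_type]
  rfl

variable [Fintype V]

/-- Every position of a walk from a uniform start is uniformly distributed. -/
theorem sum_trajectory (g : Fin 5 → Equiv.Perm V) (h : V → ℝ) (t : ℕ) :
    ∑ x, ∑ w, ((trajectory g t x w).map h).sum = (t + 1) * 5 ^ t * ∑ x, h x := by
  induction t with
  | zero => simp [trajectory]
  | succ t ih =>
    simp_rw [sum_words_succ, trajectory, Fin.cons_zero, Fin.tail_cons, List.map_cons,
      List.sum_cons, Finset.sum_add_distrib]
    have h2 : ∑ x, ∑ i, ∑ w, ((trajectory g t (g i x) w).map h).sum =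
        5 * ((t + 1) * 5 ^ t * ∑ x, h x) := by
      rw [Finset.sum_comm]
      have : ∀ i, ∑ x, ∑ w, ((trajectory g t (g i x) w).map h).sum =
          (t + 1) * 5 ^ t * ∑ x, h x := by
        intro i
        rw [← ih]
        exact Equiv.sum_comp (g i) fun x => ∑ w, ((trajectory g t x w).map h).sum
      simp [this]
    rw [h2]
    simp [← Finset.mul_sum]
    ring

/-- A uniform spectral gap for a family of five permutations. -/
structure HasGap (g : Fin 5 → Equiv.Perm V) : Prop where
  zero : g 0 = 1
  gap : ∀ f : V → ℝ, ∑ x, f x = 0 → ∑ x, f x ^ 2 ≤ 32 * ∑ i, ∑ x, (f (g i x) - f x) ^ 2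

theorem HasGap.sum_sq_le {g : Fin 5 → Equiv.Perm V} (hg : HasGap g) (A : Finset V)
    (hA : 4 * A.card ≤ 3 * Fintype.card V) (f : V → ℝ) (hf : ∀ x, x ∉ A → f x = 0) :
    ∑ x, (∑ i, f (g i x)) ^ 2 ≤ (25 - 1 / 128) * ∑ x, f x ^ 2 := by
  have hsq : ∀ i, ∑ x, f (g i x) ^ 2 = ∑ x, f x ^ 2 := fun i =>
    Equiv.sum_comp (g i) fun x => f x ^ 2
  have h1 : ∑ x, (∑ i, f (g i x)) ^ 2 ≤
      ∑ x, (5 * ∑ i, f (g i x) ^ 2 - ∑ i, (f (g i x) - f x) ^ 2) := by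
    refine Finset.sum_le_sum fun x _ => ?_
    have h0 : f (g 0 x) = f x := by rw [hg.zero]; rfl
    simp only [Fin.sum_univ_five, h0]
    nlinarith [sq_nonneg (f (g 1 x) - f (g 2 x)), sq_nonneg (f (g 1 x) - f (g 3 x)),
      sq_nonneg (f (g 1 x) - f (g 4 x)), sq_nonneg (f (g 2 x) - f (g 3 x)),
      sq_nonneg (f (g 2 x) - f (g 4 x)), sq_nonneg (f (g 3 x) - f (g 4 x))]
  rw [Finset.sum_sub_distrib, ← Finset.mul_sum, Finset.sum_comm] at h1
  simp only [hsq, Finset.sum_const, Finset.card_univ, Fintype.card_fin] at h1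
  have h2 : ∑ x, f x ^ 2 ≤ 128 * ∑ i, ∑ x, (f (g i x) - f x) ^ 2 := by
    rcases isEmpty_or_nonempty V with hV | hV
    · simp
    have hn : (0 : ℝ) < Fintype.card V := by exact_mod_cast Fintype.card_pos
    set n : ℝ := (Fintype.card V : ℝ) with hn'
    set μ : ℝ := (∑ x, f x) / n with hμ
    have hgap := hg.gap (fun x => f x - μ) (by
      rw [Finset.sum_sub_distrib, Finset.sum_const, Finset.card_univ, nsmul_eq_mul, hμ, ← hn']
      field_simp
      simp)
    simp only [sub_sub_sub_cancel_right] at hgap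
    have hexp : ∑ x, (f x - μ) ^ 2 = ∑ x, f x ^ 2 - (∑ x, f x) ^ 2 / n := by
      simp only [sub_sq, Finset.sum_add_distrib, Finset.sum_sub_distrib, Finset.sum_const,
        Finset.card_univ, nsmul_eq_mul, ← Finset.sum_mul, ← Finset.mul_sum, ← hn', hμ]
      field_simp
      ring
    have hcs : (∑ x, f x) ^ 2 ≤ A.card * ∑ x, f x ^ 2 := by
      have e1 : ∑ x, f x = ∑ x ∈ A, f x :=
        (Finset.sum_subset (Finset.subset_univ A) fun x _ hx => hf x hx).symm
      rw [e1]
      refine sq_sum_le_card_mul_sum_sq.trans ?_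
      gcongr
      exact Finset.subset_univ A
    have hA' : (4 : ℝ) * A.card ≤ 3 * n := by rw [hn']; exact_mod_cast hA
    have hdiv : (∑ x, f x) ^ 2 / n ≤ 3 / 4 * ∑ x, f x ^ 2 := by
      rw [div_le_iff₀ hn]
      have : 0 ≤ ∑ x, f x ^ 2 := Finset.sum_nonneg fun _ _ => sq_nonneg _
      nlinarith
    rw [hexp] at hgap
    linarith
  simp only [nsmul_eq_mul] at h1
  push_cast at h1
  linarith [h1, h2, Finset.sum_comm (s := Finset.univ) (t := Finset.univ)
    (f := fun (x : V) (i : Fin 5) => (f (g i x) - f x) ^ 2)]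

/-- The number of words of length `t` whose walk from `x` stays in `A`. -/
noncomputable def stayCount (g : Fin 5 → Equiv.Perm V) (A : Finset V) (t : ℕ) (x : V) : ℝ :=
  ∑ w, if ∀ y ∈ trajectory g t x w, y ∈ A then 1 else 0

theorem stayCount_succ (g : Fin 5 → Equiv.Perm V) (A : Finset V) (t : ℕ) (x : V) :
    stayCount g A (t + 1) x = if x ∈ A then ∑ i, stayCount g A t (g i x) else 0 := by
  simp only [stayCount, sum_words_succ, trajectory, Fin.cons_zero, Fin.tail_cons,
    List.forall_mem_cons]
  split_ifs with h <;> simp [h]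

theorem stayCount_eq_zero (g : Fin 5 → Equiv.Perm V) (A : Finset V) (t : ℕ) (x : V)
    (hx : x ∉ A) : stayCount g A t x = 0 := by
  cases t with
  | zero => simp [stayCount, trajectory, hx]
  | succ t => simp [stayCount_succ, hx]

theorem HasGap.sum_sq_stayCount_le {g : Fin 5 → Equiv.Perm V} (hg : HasGap g) (A : Finset V)
    (hA : 4 * A.card ≤ 3 * Fintype.card V) (t : ℕ) :
    ∑ x, stayCount g A t x ^ 2 ≤ Fintype.card V * (25 - 1 / 128 : ℝ) ^ t := by
  induction t with
  | zero =>
    rw [pow_zero, mul_one]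
    refine (Finset.sum_le_card_nsmul _ _ 1 fun x _ => ?_).trans (by simp)
    simp only [stayCount, trajectory, List.mem_singleton, forall_eq]
    split_ifs <;> simp
  | succ t ih =>
    calc ∑ x, stayCount g A (t + 1) x ^ 2 ≤ ∑ x, (∑ i, stayCount g A t (g i x)) ^ 2 := by
          refine Finset.sum_le_sum fun x _ => ?_
          rw [stayCount_succ]
          split_ifs
          · exact le_rfl
          · simpa using sq_nonneg _
      _ ≤ (25 - 1 / 128) * ∑ x, stayCount g A t x ^ 2 :=
          hg.sum_sq_le A hA _ fun x hx => stayCount_eq_zero g A t x hx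
      _ ≤ (25 - 1 / 128) * (Fintype.card V * (25 - 1 / 128 : ℝ) ^ t) := by gcongr
      _ = _ := by ring

/-- A walk of length `2 * s` stays in a set of density at most `3 / 4` with probability
exponentially small in `s`. -/
theorem HasGap.sum_stayCount_le {g : Fin 5 → Equiv.Perm V} (hg : HasGap g) (A : Finset V)
    (hA : 4 * A.card ≤ 3 * Fintype.card V) (s : ℕ) :
    ∑ x, stayCount g A (2 * s) x ≤ Fintype.card V * (25 - 1 / 128 : ℝ) ^ s := by
  have h1 : (∑ x, stayCount g A (2 * s) x) ^ 2 ≤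
      Fintype.card V * ∑ x, stayCount g A (2 * s) x ^ 2 := sq_sum_le_card_mul_sum_sq
  have h2 := hg.sum_sq_stayCount_le A hA (2 * s)
  have h3 : (0 : ℝ) ≤ Fintype.card V := by positivity
  have h4 : (0 : ℝ) ≤ (25 - 1 / 128 : ℝ) ^ s := pow_nonneg (by norm_num) s
  refine le_of_pow_le_pow_left₀ two_ne_zero (by positivity)
    (h1.trans ((mul_le_mul_of_nonneg_left h2 h3).trans (le_of_eq ?_)))
  rw [mul_comm 2 s, pow_mul]
  ring

/-- The number of walks of length `2 * s` that visit at most `a` of the `M` parts of a partition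
of `V` into small parts. -/
theorem HasGap.card_few_visits_le {g : Fin 5 → Equiv.Perm V} (hg : HasGap g) {M : ℕ}
    (b : V → Fin M) (q a : ℕ) (hb : ∀ j, (Finset.univ.filter fun x => b x = j).card ≤ q)
    (ha : 4 * (a * q) ≤ 3 * Fintype.card V) (s : ℕ) :
    ((Finset.univ.filter fun p : V × (Fin (2 * s) → Fin 5) =>
      ((trajectory g (2 * s) p.1 p.2).toFinset.image b).card ≤ a).card : ℝ) ≤
      2 ^ M * (Fintype.card V * (25 - 1 / 128 : ℝ) ^ s) := by
  set F : Finset (Finset (Fin M)) := Finset.univ.filter fun A => A.card ≤ a with hF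
  set E : Finset (Fin M) → Finset (V × (Fin (2 * s) → Fin 5)) := fun A =>
    Finset.univ.filter fun p =>
      ∀ y ∈ trajectory g (2 * s) p.1 p.2, y ∈ Finset.univ.filter fun x => b x ∈ A with hE
  have h1 : (Finset.univ.filter fun p : V × (Fin (2 * s) → Fin 5) =>
      ((trajectory g (2 * s) p.1 p.2).toFinset.image b).card ≤ a) ⊆ F.biUnion E := by
    intro p hp
    simp only [Finset.mem_filter, Finset.mem_univ, true_and] at hp
    simp only [Finset.mem_biUnion]
    refine ⟨(trajectory g (2 * s) p.1 p.2).toFinset.image b, ?_, ?_⟩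
    · simpa [hF] using hp
    · simp only [hE, Finset.mem_filter, Finset.mem_univ, true_and]
      intro y hy
      exact Finset.mem_image_of_mem b (List.mem_toFinset.2 hy)
  have h2 : ∀ A ∈ F, ((E A).card : ℝ) ≤ Fintype.card V * (25 - 1 / 128 : ℝ) ^ s := by
    intro A hA
    simp only [hF, Finset.mem_filter, Finset.mem_univ, true_and] at hA
    have hcard : (Finset.univ.filter fun x => b x ∈ A).card ≤ a * q := by
      have : (Finset.univ.filter fun x => b x ∈ A) ⊆
          A.biUnion fun j => Finset.univ.filter fun x => b x = j := by
        intro x hx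
        simpa using hx
      refine (Finset.card_le_card this).trans (Finset.card_biUnion_le.trans ?_)
      refine (Finset.sum_le_card_nsmul _ _ q fun j _ => hb j).trans ?_
      rw [smul_eq_mul]
      exact Nat.mul_le_mul_right q hA
    refine le_trans (le_of_eq ?_)
      (hg.sum_stayCount_le (Finset.univ.filter fun x => b x ∈ A) (by omega) s)
    simp only [hE, stayCount]
    rw [← Fintype.sum_prod_type', Finset.sum_boole]
  calc _ ≤ ((F.biUnion E).card : ℝ) := by exact_mod_cast Finset.card_le_card h1
    _ ≤ ∑ A ∈ F, ((E A).card : ℝ) := by exact_mod_cast Finset.card_biUnion_le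
    _ ≤ F.card • (Fintype.card V * (25 - 1 / 128 : ℝ) ^ s) := Finset.sum_le_card_nsmul _ _ _ h2
    _ ≤ 2 ^ M * (Fintype.card V * (25 - 1 / 128 : ℝ) ^ s) := by
      rw [nsmul_eq_mul]
      have : F.card ≤ 2 ^ M := by
        refine (Finset.card_le_univ F).trans ?_
        simp
      have : (F.card : ℝ) ≤ 2 ^ M := by exact_mod_cast this
      gcongr

end Walk

section WordMetric

variable {V : Type*}

/-- The vertices reachable from `x` by `s` moves, each a generator or the inverse of one. -/
noncomputable def ball (g : Fin 5 → Equiv.Perm V) : ℕ → V → Finset V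
  | 0, x => {x}
  | s + 1, x => Finset.univ.biUnion fun i =>
      ball g s (g i x) ∪ ball g s ((g i).symm x)

theorem mem_ball_succ {g : Fin 5 → Equiv.Perm V} {s : ℕ} {x y : V} :
    y ∈ ball g (s + 1) x ↔ ∃ i, y ∈ ball g s (g i x) ∨ y ∈ ball g s ((g i).symm x) := by
  simp [ball]

theorem card_ball_le (g : Fin 5 → Equiv.Perm V) (s : ℕ) (x : V) :
    (ball g s x).card ≤ 10 ^ s := by
  induction s generalizing x with
  | zero => simp [ball]
  | succ s ih =>
    rw [ball]
    refine Finset.card_biUnion_le.trans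
      ((Finset.sum_le_card_nsmul _ _ (10 ^ s + 10 ^ s) fun i _ =>
        (Finset.card_union_le _ _).trans (add_le_add (ih _) (ih _))).trans ?_)
    simp
    ring_nf
    exact le_rfl

theorem mem_ball_trans {g : Fin 5 → Equiv.Perm V} {s s' : ℕ} {x y z : V}
    (h : y ∈ ball g s x) (h' : z ∈ ball g s' y) : z ∈ ball g (s + s') x := by
  induction s generalizing x with
  | zero =>
    simp only [ball, Finset.mem_singleton] at h
    subst h
    simpa using h'
  | succ s ih =>
    rw [mem_ball_succ] at h
    rw [Nat.succ_add, mem_ball_succ]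
    obtain ⟨i, h | h⟩ := h
    · exact ⟨i, Or.inl (ih h)⟩
    · exact ⟨i, Or.inr (ih h)⟩

theorem mem_ball_symm {g : Fin 5 → Equiv.Perm V} {s : ℕ} {x y : V}
    (h : y ∈ ball g s x) : x ∈ ball g s y := by
  induction s generalizing x with
  | zero =>
    simp only [ball, Finset.mem_singleton] at h ⊢
    exact h.symm
  | succ s ih =>
    rw [mem_ball_succ] at h
    obtain ⟨i, h | h⟩ := h
    · refine mem_ball_trans (ih h) (mem_ball_succ.2 ⟨i, Or.inr ?_⟩)
      simp [ball]
    · refine mem_ball_trans (ih h) (mem_ball_succ.2 ⟨i, Or.inl ?_⟩)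
      simp [ball]

theorem mem_ball_mono {g : Fin 5 → Equiv.Perm V} (hg : g 0 = 1) {s s' : ℕ} (hs : s ≤ s')
    {x y : V} (h : y ∈ ball g s x) : y ∈ ball g s' x := by
  induction hs with
  | refl => exact h
  | step _ ih => exact mem_ball_succ.2 ⟨0, Or.inl (by rw [hg]; exact ih)⟩

/-- The word metric, truncated at `L`. -/
noncomputable def wordDist (g : Fin 5 → Equiv.Perm V) (L : ℕ) (x y : V) : ℕ :=
  sInf {s | s = L ∨ y ∈ ball g s x}

theorem wordDist_spec (g : Fin 5 → Equiv.Perm V) (L : ℕ) (x y : V) :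
    wordDist g L x y = L ∨ y ∈ ball g (wordDist g L x y) x :=
  Nat.sInf_mem (s := {s | s = L ∨ y ∈ ball g s x}) ⟨L, Or.inl rfl⟩

theorem wordDist_le (g : Fin 5 → Equiv.Perm V) (L : ℕ) (x y : V) : wordDist g L x y ≤ L :=
  Nat.sInf_le (Or.inl rfl)

theorem wordDist_le_of_mem_ball {g : Fin 5 → Equiv.Perm V} {L s : ℕ} {x y : V}
    (h : y ∈ ball g s x) : wordDist g L x y ≤ s :=
  Nat.sInf_le (Or.inr h)

theorem wordDist_symm_le (g : Fin 5 → Equiv.Perm V) (L : ℕ) (x y : V) :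
    wordDist g L x y ≤ wordDist g L y x := by
  rcases wordDist_spec g L y x with h | h
  · rw [h]; exact wordDist_le g L x y
  · exact wordDist_le_of_mem_ball (mem_ball_symm h)

theorem wordDist_triangle (g : Fin 5 → Equiv.Perm V) (L : ℕ) (x y z : V) :
    wordDist g L x z ≤ wordDist g L x y + wordDist g L y z := by
  have hL := wordDist_le g L x z
  rcases wordDist_spec g L x y with h | h
  · omega
  rcases wordDist_spec g L y z with h' | h'
  · omega
  exact wordDist_le_of_mem_ball (mem_ball_trans h h')

theorem isMetric_wordDist (g : Fin 5 → Equiv.Perm V) {L : ℕ} (hL : 0 < L) :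
    IsMetric fun x y => (wordDist g L x y : ℝ) where
  refl x := by
    have : wordDist g L x x ≤ 0 := wordDist_le_of_mem_ball (by simp [ball])
    exact_mod_cast Nat.le_zero.1 this
  pos x y hxy := by
    rw [Nat.cast_pos]
    by_contra h
    have h0 : wordDist g L x y = 0 := by omega
    rcases wordDist_spec g L x y with h' | h'
    · omega
    · rw [h0] at h'
      simp only [ball, Finset.mem_singleton] at h'
      exact hxy h'.symm
  symm x y := by
    exact_mod_cast le_antisymm (wordDist_symm_le g L x y) (wordDist_symm_le g L y x)
  triangle x y z := by exact_mod_cast wordDist_triangle g L x y z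

end WordMetric

section PathCost

variable {V : Type*} (c : V → V → ℝ)

/-- The cost of traversing the vertices of a list in order. -/
def pathCost : List V → ℝ
  | [] => 0
  | [_] => 0
  | x :: y :: l => c x y + pathCost (y :: l)

theorem pathCost_eq_sum_zip (l : List V) :
    pathCost c l = ((l.zip l.tail).map fun p => c p.1 p.2).sum := by
  induction l with
  | nil => rfl
  | cons x l ih =>
    cases l with
    | nil => simp [pathCost]
    | cons y l => simpa [pathCost] using ih

theorem tourCost_eq_pathCost (r : V) (l : List V) :
    tourCost c r l = pathCost c (r :: (l ++ [r])) := by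
  rw [pathCost_eq_sum_zip]
  rfl

variable {c}

theorem pathCost_nonneg (hc : ∀ x y, 0 ≤ c x y) (l : List V) : 0 ≤ pathCost c l := by
  induction l with
  | nil => simp [pathCost]
  | cons x l ih =>
    cases l with
    | nil => simp [pathCost]
    | cons y l => exact add_nonneg (hc x y) ih

theorem _root_.IsMetric.nonneg (hc : IsMetric c) (x y : V) : 0 ≤ c x y := by
  rcases eq_or_ne x y with rfl | h
  · exact (hc.refl x).ge
  · exact (hc.pos x y h).le

theorem pathCost_le_of_sublist (hc : IsMetric c) {l l' : List V} (h : l.Sublist l') :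
    pathCost c l ≤ pathCost c l' ∧ ∀ x, pathCost c (x :: l) ≤ pathCost c (x :: l') := by
  induction h with
  | slnil => exact ⟨le_rfl, fun _ => le_rfl⟩
  | @cons l l' a h ih =>
    have hnil : pathCost c l' ≤ pathCost c (a :: l') := by
      cases l' with
      | nil => exact le_rfl
      | cons b l' =>
        have := hc.nonneg a b
        simp only [pathCost]
        linarith
    refine ⟨ih.1.trans hnil, fun x => ?_⟩
    refine (ih.2 x).trans ?_
    cases l' with
    | nil => simpa [pathCost] using hc.nonneg x a
    | cons b l' =>
      have := hc.triangle x a b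
      simp only [pathCost]
      linarith
  | @cons_cons l l' a h ih =>
    refine ⟨ih.2 a, fun x => ?_⟩
    have := ih.2 a
    simp only [pathCost]
    linarith

theorem pathCost_le_pathCost_append (hc : ∀ x y, 0 ≤ c x y) (l l' : List V) :
    pathCost c l ≤ pathCost c (l ++ l') := by
  induction l with
  | nil => exact pathCost_nonneg hc _
  | cons x l ih =>
    cases l with
    | nil => exact pathCost_nonneg hc _
    | cons y l =>
      have : pathCost c (y :: l) ≤ pathCost c (y :: (l ++ l')) := ih
      simp only [List.cons_append, pathCost]
      linarith

theorem pathCost_le_tourCost (hc : ∀ x y, 0 ≤ c x y) (r : V) (l : List V) :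
    pathCost c l ≤ tourCost c r l := by
  rw [tourCost_eq_pathCost]
  refine (pathCost_le_pathCost_append hc l [r]).trans ?_
  cases h : l ++ [r] with
  | nil => exact le_rfl
  | cons y l' =>
    have := hc r y
    simp only [pathCost]
    linarith

/-- Joining two paths costs at most one extra step. -/
theorem pathCost_append_le {K : ℝ} (hK0 : 0 ≤ K) (hK : ∀ x y, c x y ≤ K) (l l' : List V) :
    pathCost c (l ++ l') ≤ pathCost c l + K + pathCost c l' := by
  induction l with
  | nil => simp [pathCost, hK0]
  | cons x l ih =>
    cases l with
    | nil =>
      cases l' with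
      | nil => simp [pathCost, hK0]
      | cons y l' =>
        have := hK x y
        simp only [List.cons_append, List.nil_append, pathCost]
        linarith
    | cons y l =>
      have : pathCost c (y :: (l ++ l')) ≤ pathCost c (y :: l) + K + pathCost c l' := ih
      simp only [List.cons_append, pathCost]
      linarith

theorem optTSP_le_pathCost [DecidableEq V] (hc : IsMetric c) {K : ℝ} (hK0 : 0 ≤ K)
    (hK : ∀ x y, c x y ≤ K) (r : V) (l : List V) :
    optTSP c r l.toFinset ≤ pathCost c l + 2 * K := by
  have h1 : optTSP c r l.toFinset ≤ tourCost c r l.dedup := by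
    refine csInf_le ⟨0, ?_⟩ ⟨l.dedup, l.nodup_dedup, ?_, rfl⟩
    · rintro y ⟨l', -, -, rfl⟩
      rw [tourCost_eq_pathCost]
      exact pathCost_nonneg hc.nonneg _
    · ext x; simp
  refine h1.trans ?_
  rw [tourCost_eq_pathCost]
  have h2 := pathCost_append_le hK0 hK [r] (l.dedup ++ [r])
  have h3 := pathCost_append_le hK0 hK l.dedup [r]
  have h4 := (pathCost_le_of_sublist hc (List.dedup_sublist l)).1
  simp only [pathCost, List.cons_append, List.nil_append] at h2 h3
  linarith

theorem pathCost_trajectory_le (g : Fin 5 → Equiv.Perm V) (L t : ℕ) (x : V)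
    (w : Fin t → Fin 5) :
    pathCost (fun x y => (wordDist g L x y : ℝ)) (trajectory g t x w) ≤ t := by
  induction t generalizing x with
  | zero => simp [trajectory, pathCost]
  | succ t ih =>
    have h1 : wordDist g L x (g (w 0) x) ≤ 1 :=
      wordDist_le_of_mem_ball (mem_ball_succ.2 ⟨w 0, Or.inl (by simp [ball])⟩)
    have h1' : (wordDist g L x (g (w 0) x) : ℝ) ≤ 1 := by exact_mod_cast h1
    have h2 := ih (g (w 0) x) (Fin.tail w)
    have h3 : ∃ l, trajectory g t (g (w 0) x) (Fin.tail w) = g (w 0) x :: l := by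
      cases t with
      | zero => exact ⟨[], rfl⟩
      | succ t => exact ⟨_, rfl⟩
    obtain ⟨l, hl⟩ := h3
    rw [trajectory, hl]
    rw [hl] at h2
    simp only [pathCost]
    push_cast
    linarith

/-- If a list runs through blocks in order, and each of its entries belongs to one of two
families at mutual distance at least `K`, then every block meeting both families costs `K`. -/
theorem mul_card_le_pathCost [DecidableEq V] {ι : Type*} [PartialOrder ι] [DecidableEq ι]
    (hc : IsMetric c) {K : ℝ} (hK : 0 < K) (b : V → ι) (U W : V → Prop) [DecidablePred U]
    [DecidablePred W] (hUW : ∀ x y, U x → W y → K ≤ c x y) (l : List V)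
    (hl : l.Pairwise fun x y => b x ≤ b y) (hcov : ∀ x ∈ l, U x ∨ W x) :
    K * ((l.toFinset.filter U).image b ∩ (l.toFinset.filter W).image b).card ≤
      pathCost c l := by
  induction l with
  | nil => simp [pathCost]
  | cons x l ih =>
    rw [List.pairwise_cons] at hl
    have ih' := ih hl.2 fun y hy => hcov y (List.mem_cons_of_mem x hy)
    set S := (l.toFinset.filter U).image b ∩ (l.toFinset.filter W).image b with hS
    set S' := ((x :: l).toFinset.filter U).image b ∩ ((x :: l).toFinset.filter W).image b with hS'
    have hstep : pathCost c l ≤ pathCost c (x :: l) :=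
      (pathCost_le_of_sublist hc (List.sublist_cons_self x l)).1
    have hnot : ¬ (U x ∧ W x) := fun h => by
      have := hUW x x h.1 h.2
      rw [hc.refl] at this
      linarith
    have hsub : S' ⊆ insert (b x) S := by
      intro j hj
      simp only [hS, hS', Finset.mem_inter, Finset.mem_image, Finset.mem_filter,
        List.mem_toFinset, List.mem_cons, Finset.mem_insert] at hj ⊢
      obtain ⟨⟨u, ⟨rfl | hu, hu'⟩, rfl⟩, ⟨v, ⟨rfl | hv, hv'⟩, hvj⟩⟩ := hj
      · exact Or.inl rfl
      · exact Or.inl rfl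
      · exact Or.inl hvj.symm
      · exact Or.inr ⟨⟨u, ⟨hu, hu'⟩, rfl⟩, ⟨v, ⟨hv, hv'⟩, hvj⟩⟩
    by_cases hmem : b x ∈ S' ∧ b x ∉ S
    · have hcard : (S'.card : ℝ) ≤ S.card + 1 := by
        exact_mod_cast (Finset.card_le_card hsub).trans (Finset.card_insert_le _ _)
      obtain ⟨h1, h2⟩ := hmem
      simp only [hS, hS', Finset.mem_inter, Finset.mem_image, Finset.mem_filter,
        List.mem_toFinset, List.mem_cons] at h1 h2
      have hz : ∃ z ∈ l, b z = b x ∧ ((U z ∧ W x) ∨ (W z ∧ U x)) := by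
        obtain ⟨⟨u, ⟨hu, hu'⟩, hub⟩, ⟨v, ⟨hv, hv'⟩, hvb⟩⟩ := h1
        rcases hu with rfl | hu <;> rcases hv with rfl | hv
        · exact absurd ⟨hu', hv'⟩ hnot
        · exact ⟨v, hv, hvb, Or.inr ⟨hv', hu'⟩⟩
        · exact ⟨u, hu, hub, Or.inl ⟨hu', hv'⟩⟩
        · exact absurd ⟨⟨u, ⟨hu, hu'⟩, hub⟩, ⟨v, ⟨hv, hv'⟩, hvb⟩⟩ h2
      obtain ⟨z, hzl, hzb, hzUW⟩ := hz
      cases l with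
      | nil => simp at hzl
      | cons y l =>
        have hyb : b y = b x := by
          apply le_antisymm _ (hl.1 y (by simp))
          rw [← hzb]
          rcases List.mem_cons.1 hzl with rfl | h
          · exact le_rfl
          · exact (List.pairwise_cons.1 hl.2).1 z h
        have hxy : K ≤ c x y := by
          rcases hcov y (by simp) with hy | hy <;> rcases hzUW with ⟨hz, hx⟩ | ⟨hz, hx⟩
          · rw [hc.symm]; exact hUW y x hy hx
          · exact absurd ⟨⟨y, ⟨by simp, hy⟩, hyb⟩, ⟨z, ⟨hzl, hz⟩, hzb⟩⟩ h2
          · exact absurd ⟨⟨z, ⟨hzl, hz⟩, hzb⟩, ⟨y, ⟨by simp, hy⟩, hyb⟩⟩ h2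
          · exact hUW x y hx hy
        simp only [pathCost]
        nlinarith
    · have hsub' : S' ⊆ S := by
        intro j hj
        rcases Finset.mem_insert.1 (hsub hj) with rfl | h
        · by_contra h
          exact hmem ⟨hj, h⟩
        · exact h
      have hcard : (S'.card : ℝ) ≤ S.card := by exact_mod_cast Finset.card_le_card hsub'
      nlinarith

end PathCost

section Averaging

theorem exists_pr_le {A Ω : Type*} [Fintype Ω] [Nonempty Ω] (D : FinDist A)
    (good : A → Ω → Prop) (p : ℝ)
    (h : ∀ a, ((Finset.univ.filter fun ω => good a ω).card : ℝ) ≤ p * Fintype.card Ω) :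
    ∃ ω, D.pr (fun a => good a ω) ≤ p := by
  by_contra hcon
  push Not at hcon
  have h1 : ∑ _ω : Ω, p < ∑ ω, D.pr fun a => good a ω :=
    Finset.sum_lt_sum_of_nonempty Finset.univ_nonempty fun ω _ => hcon ω
  have h2 : ∑ ω, D.pr (fun a => good a ω) =
      ∑ a ∈ D.support, D.w a * ((Finset.univ.filter fun ω => good a ω).card : ℝ) := by
    simp only [FinDist.pr, Finset.sum_filter]
    rw [Finset.sum_comm]
    refine Finset.sum_congr rfl fun a _ => ?_
    rw [← Finset.sum_filter, Finset.sum_const, nsmul_eq_mul, mul_comm]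
  have h3 : ∑ a ∈ D.support, D.w a * ((Finset.univ.filter fun ω => good a ω).card : ℝ) ≤
      ∑ a ∈ D.support, D.w a * (p * Fintype.card Ω) :=
    Finset.sum_le_sum fun a _ => mul_le_mul_of_nonneg_left (h a) (D.nonneg a)
  have h4 : ∑ a ∈ D.support, D.w a = 1 := D.total
  rw [← Finset.sum_mul, h4, one_mul] at h3
  rw [Finset.sum_const, Finset.card_univ, nsmul_eq_mul, h2] at h1
  linarith

end Averaging

section Main

theorem exists_hasGap (m : ℕ) [NeZero m] :
    ∃ g : Fin 5 → Equiv.Perm (Fin (m * m)), HasGap g := by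
  have e : ZMod m × ZMod m ≃ Fin (m * m) := Fintype.equivFinOfCardEq (by simp [ZMod.card])
  refine ⟨fun i => e.permCongr (![1, shiftFst, shiftSnd, shearFst, shearSnd] i), ?_, ?_⟩
  · ext x; simp [Equiv.permCongr_apply]
  · intro f hf
    have h := sum_sq_le_of_sum_eq_zero (fun p => f (e p)) (by rw [Equiv.sum_comp e f]; exact hf)
    rw [Equiv.sum_comp e fun x => f x ^ 2] at h
    refine h.trans ?_
    have hs : ∀ s : Equiv.Perm (ZMod m × ZMod m),
        ∑ x, (f (e.permCongr s x) - f x) ^ 2 = ∑ p, (f (e (s p)) - f (e p)) ^ 2 := by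
      intro s
      rw [← Equiv.sum_comp e]
      simp [Equiv.permCongr_apply]
    simp only [hs, Fin.sum_univ_five]
    simp

/-- The number of walks of length `t` coming within distance `L` of a vertex of `u`. -/
theorem card_close_le {V : Type*} [Fintype V] (g : Fin 5 → Equiv.Perm V) (L t : ℕ) (u : List V) :
    ((Finset.univ.filter fun p : V × (Fin t → Fin 5) =>
      ∃ x ∈ u, ∃ y ∈ trajectory g t p.1 p.2, y ∈ ball g L x).card : ℝ) ≤
      (t + 1) * 5 ^ t * (u.length * 10 ^ L) := by
  set F : Finset V := u.toFinset.biUnion (ball g L) with hF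
  set h : V → ℝ := fun y => if y ∈ F then 1 else 0 with hh
  have hnn : ∀ y, 0 ≤ h y := fun y => by simp only [hh]; split_ifs <;> norm_num
  have hFc : (F.card : ℝ) ≤ u.length * 10 ^ L := by
    have : F.card ≤ u.length * 10 ^ L := by
      refine Finset.card_biUnion_le.trans
        ((Finset.sum_le_card_nsmul _ _ _ fun x _ => card_ball_le g L x).trans ?_)
      rw [smul_eq_mul]
      exact Nat.mul_le_mul_right _ (List.toFinset_card_le u)
    exact_mod_cast this
  have hsum : ∑ y, h y = F.card := by simp [hh]
  calc _ = ∑ p : V × (Fin t → Fin 5),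
        if ∃ x ∈ u, ∃ y ∈ trajectory g t p.1 p.2, y ∈ ball g L x then (1 : ℝ) else 0 := by
        rw [Finset.sum_boole]
    _ ≤ ∑ p : V × (Fin t → Fin 5), ((trajectory g t p.1 p.2).map h).sum := by
        refine Finset.sum_le_sum fun p _ => ?_
        have hl : ∀ z ∈ (trajectory g t p.1 p.2).map h, 0 ≤ z := by
          intro z hz
          obtain ⟨y, -, rfl⟩ := List.mem_map.1 hz
          exact hnn y
        split_ifs with hp
        · obtain ⟨x, hx, y, hy, hxy⟩ := hp
          have hy1 : h y = 1 := by
            simp only [hh]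
            rw [if_pos]
            exact Finset.mem_biUnion.2 ⟨x, List.mem_toFinset.2 hx, hxy⟩
          rw [← hy1]
          exact List.single_le_sum hl _ (List.mem_map_of_mem hy)
        · exact List.sum_nonneg hl
    _ = (t + 1) * 5 ^ t * F.card := by
        rw [Fintype.sum_prod_type, sum_trajectory, hsum]
    _ ≤ _ := by gcongr

theorem mem_permInduced {n : ℕ} (σ : Equiv.Perm (Fin n)) (X : Finset (Fin n)) (v : Fin n) :
    v ∈ permInduced σ X ↔ v ∈ X := by
  simp only [permInduced, List.mem_filter, List.mem_map, List.mem_finRange, true_and,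
    decide_eq_true_eq, and_iff_right_iff_imp]
  exact fun _ => ⟨σ.symm v, by simp⟩

theorem pairwise_permInduced {n : ℕ} (σ : Equiv.Perm (Fin n)) (X : Finset (Fin n)) :
    (permInduced σ X).Pairwise fun x y => σ.symm x ≤ σ.symm y := by
  refine List.Pairwise.filter _ (List.pairwise_map.2 ?_)
  simpa using (List.pairwise_lt_finRange n).imp fun h => h.le

/-- A tour is expensive on a union of two distant walks that both visit most of the blocks. -/
theorem le_tourCost_permInduced {n M a : ℕ} {g : Fin 5 → Equiv.Perm (Fin n)} (hg : g 0 = 1)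
    {L : ℕ} (hL : 0 < L) (r : Fin n) (σ : Equiv.Perm (Fin n)) (b : Fin n → Fin M)
    (hb : ∀ x y, σ.symm x ≤ σ.symm y → b x ≤ b y) (u v : List (Fin n))
    (hfar : ¬ ∃ x ∈ u, ∃ y ∈ v, y ∈ ball g L x)
    (hu : a < (u.toFinset.image b).card) (hv : a < (v.toFinset.image b).card) :
    (L : ℝ) * (2 * a - M) ≤
      tourCost (fun x y => (wordDist g L x y : ℝ)) r (permInduced σ (u ++ v).toFinset) := by
  have hc := isMetric_wordDist g hL
  refine le_trans ?_ (pathCost_le_tourCost hc.nonneg r _)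
  have hL' : (0 : ℝ) < L := by exact_mod_cast hL
  refine le_trans ?_ (mul_card_le_pathCost hc hL' b (· ∈ u) (· ∈ v) ?_ _
    ((pairwise_permInduced σ _).imp fun h => hb _ _ h) ?_)
  · have e1 : ((permInduced σ (u ++ v).toFinset).toFinset.filter (· ∈ u)) = u.toFinset := by
      ext x; simp [mem_permInduced]; tauto
    have e2 : ((permInduced σ (u ++ v).toFinset).toFinset.filter (· ∈ v)) = v.toFinset := by
      ext x; simp [mem_permInduced]; tauto
    rw [e1, e2]
    have h1 := Finset.card_union_add_card_inter (u.toFinset.image b) (v.toFinset.image b)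
    have h2 : (u.toFinset.image b ∪ v.toFinset.image b).card ≤ M := by
      simpa using Finset.card_le_univ (u.toFinset.image b ∪ v.toFinset.image b)
    have h3 : 2 * a ≤ (u.toFinset.image b ∩ v.toFinset.image b).card + M := by omega
    have h4 : (2 * a : ℝ) ≤ (u.toFinset.image b ∩ v.toFinset.image b).card + M := by
      exact_mod_cast h3
    gcongr
    linarith
  · intro x y hx hy
    have : ¬ wordDist g L x y < L := by
      intro hlt
      rcases wordDist_spec g L x y with h | h
      · omega
      · exact hfar ⟨x, hx, y, hy, mem_ball_mono hg hlt.le h⟩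
    exact_mod_cast not_lt.1 this
  · intro x hx
    simpa [mem_permInduced] using hx

theorem optTSP_two_walks_le {n : ℕ} (g : Fin 5 → Equiv.Perm (Fin n)) {L : ℕ} (hL : 0 < L)
    (r : Fin n) {t : ℕ} (p q : Fin n × (Fin t → Fin 5)) :
    optTSP (fun x y => (wordDist g L x y : ℝ)) r
      (trajectory g t p.1 p.2 ++ trajectory g t q.1 q.2).toFinset ≤ 2 * t + 3 * L := by
  have hK : ∀ x y, (wordDist g L x y : ℝ) ≤ L := fun x y => by exact_mod_cast wordDist_le g L x y
  have h1 := optTSP_le_pathCost (isMetric_wordDist g hL) (Nat.cast_nonneg L) hK r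
    (trajectory g t p.1 p.2 ++ trajectory g t q.1 q.2)
  have h2 := pathCost_append_le (Nat.cast_nonneg L) hK (trajectory g t p.1 p.2)
    (trajectory g t q.1 q.2)
  have h3 := pathCost_trajectory_le g L t p.1 p.2
  have h4 := pathCost_trajectory_le g L t q.1 q.2
  linarith

/-- The number of pairs of walks of length `2 * s` on which a given tour is cheap. -/
theorem card_cheap_le {n : ℕ} {g : Fin 5 → Equiv.Perm (Fin n)} (hg : HasGap g) {L : ℕ}
    (hL : 0 < L) (r : Fin n) (σ : Equiv.Perm (Fin n)) (j s : ℕ) (hj : 0 < j) (hn : 40 * j ≤ n)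
    (K : ℝ) (hK0 : 0 ≤ K) (hK : K * (4 * s + 3 * L) < L * (2 * j)) :
    ((Finset.univ.filter fun ω :
      (Fin n × (Fin (2 * s) → Fin 5)) × (Fin n × (Fin (2 * s) → Fin 5)) =>
      tourCost (fun x y => (wordDist g L x y : ℝ)) r (permInduced σ
        (trajectory g (2 * s) ω.1.1 ω.1.2 ++ trajectory g (2 * s) ω.2.1 ω.2.2).toFinset) ≤
      K * optTSP (fun x y => (wordDist g L x y : ℝ)) r
        (trajectory g (2 * s) ω.1.1 ω.1.2 ++ trajectory g (2 * s) ω.2.1 ω.2.2).toFinset).card : ℝ) ≤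
      (n * 25 ^ s) * (2 * (2 ^ (8 * j) * (n * (25 - 1 / 128 : ℝ) ^ s)) +
        (2 * s + 1) ^ 2 * 25 ^ s * 10 ^ L) := by
  set q : ℕ := n / (8 * j) + 1 with hq
  have hq0 : 0 < q := Nat.succ_pos _
  have hbound : ∀ i : Fin n, (i : ℕ) / q < 8 * j := fun i => by
    rw [Nat.div_lt_iff_lt_mul hq0]
    have h1 := Nat.div_add_mod n (8 * j)
    have h2 := Nat.mod_lt n (show 0 < 8 * j by omega)
    have h3 : 8 * j * q = 8 * j * (n / (8 * j)) + 8 * j := by rw [hq]; ring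
    have := i.2
    omega
  set b : Fin n → Fin (8 * j) := fun x => ⟨(σ.symm x : ℕ) / q, hbound _⟩ with hb
  have hmono : ∀ x y, σ.symm x ≤ σ.symm y → b x ≤ b y := by
    intro x y h
    exact Nat.div_le_div_right h
  have hfib : ∀ i, (Finset.univ.filter fun x => b x = i).card ≤ q := by
    intro i
    have : (Finset.univ.filter fun x => b x = i).card ≤
        (Finset.Ico ((i : ℕ) * q) ((i : ℕ) * q + q)).card := by
      refine Finset.card_le_card_of_injOn (fun x => (σ.symm x : ℕ)) ?_ ?_
      · intro x hx
        have hx' : (σ.symm x : ℕ) / q = i := by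
          have : b x = i := by simpa using hx
          rw [← this]
        simp only [Finset.coe_Ico, Set.mem_Ico]
        have h1 := Nat.div_add_mod (σ.symm x : ℕ) q
        have h2 := Nat.mod_lt (σ.symm x : ℕ) hq0
        rw [hx', mul_comm] at h1
        omega
      · intro x _ y _ h
        exact σ.symm.injective (Fin.ext h)
    simpa using this
  have hsize : 4 * (5 * j * q) ≤ 3 * Fintype.card (Fin n) := by
    rw [Fintype.card_fin]
    have h1 : 8 * j * (n / (8 * j)) ≤ n := Nat.mul_div_le n (8 * j)
    have h3 : 8 * j * q = 8 * j * (n / (8 * j)) + 8 * j := by rw [hq]; ring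
    nlinarith
  set T : Fin n × (Fin (2 * s) → Fin 5) → List (Fin n) := fun p => trajectory g (2 * s) p.1 p.2
    with hT
  set few : Finset (Fin n × (Fin (2 * s) → Fin 5)) :=
    Finset.univ.filter fun p => ((T p).toFinset.image b).card ≤ 5 * j with hfew
  set close : Fin n × (Fin (2 * s) → Fin 5) → Finset (Fin n × (Fin (2 * s) → Fin 5)) := fun p =>
    Finset.univ.filter fun p' => ∃ x ∈ T p, ∃ y ∈ T p', y ∈ ball g L x with hclose
  have hfewc : (few.card : ℝ) ≤ 2 ^ (8 * j) * (n * (25 - 1 / 128 : ℝ) ^ s) := by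
    have := hg.card_few_visits_le b q (5 * j) hfib hsize s
    rw [Fintype.card_fin] at this
    convert this
  have hclosec : ∀ p, ((close p).card : ℝ) ≤ (2 * s + 1) ^ 2 * 25 ^ s * 10 ^ L := by
    intro p
    have := card_close_le g L (2 * s) (T p)
    rw [length_trajectory] at this
    have e : ((2 * s : ℕ) + 1 : ℝ) * 5 ^ (2 * s) * ((2 * s + 1 : ℕ) * 10 ^ L) =
        (2 * s + 1) ^ 2 * 25 ^ s * 10 ^ L := by
      rw [pow_mul]
      push_cast
      norm_num
      ring
    rw [e] at this
    convert this
  have hΩ : (Fintype.card (Fin n × (Fin (2 * s) → Fin 5)) : ℝ) = n * 25 ^ s := by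
    simp [pow_mul]
  have hsub : (Finset.univ.filter fun ω :
      (Fin n × (Fin (2 * s) → Fin 5)) × (Fin n × (Fin (2 * s) → Fin 5)) =>
      tourCost (fun x y => (wordDist g L x y : ℝ)) r (permInduced σ (T ω.1 ++ T ω.2).toFinset) ≤
      K * optTSP (fun x y => (wordDist g L x y : ℝ)) r (T ω.1 ++ T ω.2).toFinset) ⊆
      (few ×ˢ Finset.univ ∪ Finset.univ ×ˢ few) ∪
        Finset.univ.biUnion fun p => (close p).map ⟨Prod.mk p, Prod.mk_right_injective p⟩ := by
    intro ω hω
    simp only [Finset.mem_filter, Finset.mem_univ, true_and] at hω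
    by_contra hcon
    simp only [Finset.mem_union, Finset.mem_product, Finset.mem_univ, and_true, true_and,
      Finset.mem_biUnion, Finset.mem_map, Function.Embedding.coeFn_mk, not_or] at hcon
    obtain ⟨⟨h1, h2⟩, h3⟩ := hcon
    simp only [hfew, Finset.mem_filter, Finset.mem_univ, true_and, not_le] at h1 h2
    have hfar : ¬ ∃ x ∈ T ω.1, ∃ y ∈ T ω.2, y ∈ ball g L x := fun h =>
      h3 ⟨ω.1, ω.2, by simpa [hclose] using h, rfl⟩
    have hlow := le_tourCost_permInduced hg.zero hL r σ b hmono _ _ hfar h1 h2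
    have hup := mul_le_mul_of_nonneg_left (optTSP_two_walks_le g hL r ω.1 ω.2) hK0
    push_cast at hlow hup
    have e1 : (L : ℝ) * (2 * (5 * j) - 8 * j) = L * (2 * j) := by ring
    have e2 : K * (2 * (2 * s) + 3 * L) = K * (4 * s + 3 * L) := by ring
    rw [e1] at hlow
    rw [e2] at hup
    linarith
  have hcard : ((Finset.univ.filter fun ω :
      (Fin n × (Fin (2 * s) → Fin 5)) × (Fin n × (Fin (2 * s) → Fin 5)) =>
      tourCost (fun x y => (wordDist g L x y : ℝ)) r (permInduced σ (T ω.1 ++ T ω.2).toFinset) ≤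
      K * optTSP (fun x y => (wordDist g L x y : ℝ)) r (T ω.1 ++ T ω.2).toFinset).card : ℝ) ≤
      (few.card * (n * 25 ^ s) + (n * 25 ^ s) * few.card) + ∑ p, ((close p).card : ℝ) := by
    rw [← hΩ]
    have h := (Finset.card_le_card hsub).trans ((Finset.card_union_le _ _).trans
      (add_le_add (Finset.card_union_le _ _) Finset.card_biUnion_le))
    simp only [Finset.card_product, Finset.card_map, Finset.card_univ] at h
    exact_mod_cast h
  have hsumc : ∑ p, ((close p).card : ℝ) ≤
      (n * 25 ^ s) * ((2 * s + 1) ^ 2 * 25 ^ s * 10 ^ L) := by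
    refine (Finset.sum_le_card_nsmul _ _ _ fun p _ => hclosec p).trans (le_of_eq ?_)
    rw [nsmul_eq_mul, Finset.card_univ, hΩ]
  have hpos : (0 : ℝ) ≤ n * 25 ^ s := by positivity
  refine hcard.trans ?_
  nlinarith [mul_le_mul_of_nonneg_left hfewc hpos]

/-- The numerical trade-off between the two ways in which a pair of walks can be cheap. -/
theorem cheap_bound_le {τ j : ℕ} (hτ : ((25 - 1 / 128) / 25 : ℝ) ^ τ ≤ (1 / 2) ^ 10)
    (hj : 2 * τ + 3 ≤ j) :
    2 * (2 ^ (8 * j) * ((10 : ℝ) ^ (16 * j) * (25 - 1 / 128 : ℝ) ^ (τ * j))) +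
        (2 * (τ * j : ℕ) + 1) ^ 2 * 25 ^ (τ * j) * 10 ^ (8 * j) ≤
      1 / 2 * (1 / 2) ^ j * (10 ^ (16 * j) * 25 ^ (τ * j)) := by
  set y : ℝ := 2 ^ j with hy
  set N : ℝ := 10 ^ (8 * j) with hN
  set z : ℝ := 25 ^ (τ * j) with hz
  have hN2 : (10 : ℝ) ^ (16 * j) = N ^ 2 := by rw [hN, ← pow_mul]; congr 1; ring
  have hz0 : 0 < z := by positivity
  have hy8 : 8 ≤ y := by
    calc (8 : ℝ) = 2 ^ 3 := by norm_num
      _ ≤ 2 ^ j := pow_le_pow_right₀ (by norm_num) (by omega)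
  have hy0 : 0 < y := by linarith
  have hjy : (j : ℝ) ≤ y := by
    rw [hy]
    exact_mod_cast (Nat.lt_two_pow_self (n := j)).le
  have hNy : y ^ 8 ≤ N := by
    rw [hy, hN, ← pow_mul, mul_comm j 8]
    gcongr
    norm_num
  have hκ : (25 - 1 / 128 : ℝ) ^ (τ * j) ≤ z / y ^ 10 := by
    have e : (25 - 1 / 128 : ℝ) ^ (τ * j) = (((25 - 1 / 128) / 25 : ℝ) ^ τ) ^ j * z := by
      rw [hz, ← pow_mul, ← mul_pow]
      congr 1
      norm_num
    have h1 : (((25 - 1 / 128) / 25 : ℝ) ^ τ) ^ j ≤ ((1 / 2 : ℝ) ^ 10) ^ j :=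
      pow_le_pow_left₀ (pow_nonneg (by norm_num) _) hτ j
    have h2 : ((1 / 2 : ℝ) ^ 10) ^ j = 1 / y ^ 10 := by
      rw [hy, ← pow_mul, mul_comm, pow_mul, one_div_pow, one_div_pow]
    have h3 : z / y ^ 10 = ((1 / 2 : ℝ) ^ 10) ^ j * z := by rw [h2]; ring
    rw [e, h3]
    exact mul_le_mul_of_nonneg_right h1 hz0.le
  have hs : (2 * (τ * j : ℕ) + 1 : ℝ) ≤ y ^ 2 := by
    have h1 : 2 * (τ * j) + 1 ≤ j * j := by nlinarith
    have h2 : (2 * (τ * j : ℕ) + 1 : ℝ) ≤ j * j := by exact_mod_cast h1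
    have h3 : (0 : ℝ) ≤ j := by positivity
    nlinarith
  have h8 : (2 : ℝ) ^ (8 * j) = y ^ 8 := by rw [hy, ← pow_mul, mul_comm]
  have hhalf : (1 / 2 : ℝ) ^ j = 1 / y := by rw [hy, one_div_pow]
  rw [hN2, h8, hhalf]
  have hN0 : 0 < N := by positivity
  have first : 2 * (y ^ 8 * (N ^ 2 * (25 - 1 / 128 : ℝ) ^ (τ * j))) ≤ N ^ 2 * z / (4 * y) := by
    calc 2 * (y ^ 8 * (N ^ 2 * (25 - 1 / 128 : ℝ) ^ (τ * j)))
        ≤ 2 * (y ^ 8 * (N ^ 2 * (z / y ^ 10))) := by gcongr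
      _ = N ^ 2 * z * 2 / y ^ 2 := by field_simp
      _ ≤ N ^ 2 * z / (4 * y) := by
        rw [div_le_div_iff₀ (by positivity) (by positivity)]
        have : 0 < N ^ 2 * z := by positivity
        have : 0 ≤ (N ^ 2 * z * y) * (y - 8) :=
          mul_nonneg (by positivity) (by linarith)
        nlinarith
  have second : (2 * (τ * j : ℕ) + 1) ^ 2 * z * N ≤ N ^ 2 * z / (4 * y) := by
    have h4 : y ^ 4 * (4 * y) ≤ N := by
      refine le_trans ?_ hNy
      have h3 : 8 ^ 3 ≤ y ^ 3 := pow_le_pow_left₀ (by norm_num) hy8 3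
      have h5 : 0 < y ^ 5 := by positivity
      nlinarith
    rw [le_div_iff₀ (by positivity)]
    calc (2 * (τ * j : ℕ) + 1) ^ 2 * z * N * (4 * y) ≤ (y ^ 2) ^ 2 * z * N * (4 * y) := by gcongr
      _ = (y ^ 4 * (4 * y)) * (z * N) := by ring
      _ ≤ N * (z * N) := by gcongr
      _ = N ^ 2 * z := by ring
  calc _ ≤ N ^ 2 * z / (4 * y) + N ^ 2 * z / (4 * y) := add_le_add first second
    _ = 1 / 2 * (1 / y) * (N ^ 2 * z) := by field_simp; norm_num

end Main

end UniversalTSP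

/-- There are constants `c0, C0, ε0 > 0` such that for infinitely many `n` there is a
metric space on `n` points with a root such that for every distribution `D` over
permutations (tours) of the vertices there is an `X` with `|X| ≤ C0·log n` and
`Pr_{σ←D}[c(σ_X) ≤ c0·log n·opt_TSP(X)] ≤ (1/2)·exp(−ε0·|X|)`. -/
theorem universal_tsp_strong_lower_bound :
    ∃ c0 > (0 : ℝ), ∃ C0 > (0 : ℝ), ∃ ε0 > (0 : ℝ),
      {n : ℕ | ∃ (c : Fin n → Fin n → ℝ) (r : Fin n), IsMetric c ∧
        ∀ D : FinDist (Equiv.Perm (Fin n)),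
          ∃ X : Finset (Fin n),
            (X.card : ℝ) ≤ C0 * Real.log n ∧
            D.pr (fun σ =>
                tourCost c r (permInduced σ X) ≤ c0 * Real.log n * optTSP c r X)
              ≤ (1 / 2) * Real.exp (-ε0 * X.card)}.Infinite := by
  obtain ⟨τ, hτ⟩ := exists_pow_lt_of_lt_one (show (0 : ℝ) < (1 / 2) ^ 10 by norm_num)
    (show ((25 - 1 / 128) / 25 : ℝ) < 1 by norm_num)
  have hτ0 : 0 < τ := by
    rcases Nat.eq_zero_or_pos τ with rfl | h
    · norm_num at hτ
    · exact h
  have hτR : (1 : ℝ) ≤ τ := by exact_mod_cast hτ0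
  have hlog10 : 9 / 10 ≤ Real.log 10 := by
    have := Real.one_sub_inv_le_log_of_pos (show (0 : ℝ) < 10 by norm_num)
    norm_num at this ⊢
    linarith
  have hlog2 : 0 < Real.log 2 := Real.log_pos (by norm_num)
  refine ⟨1 / (2 * Real.log 10 * (4 * τ + 24)), by positivity, 6 * τ, by positivity,
    Real.log 2 / (6 * τ), by positivity, ?_⟩
  refine Set.infinite_of_forall_exists_gt fun N => ?_
  obtain ⟨j, hjN, hjτ⟩ : ∃ j, N ≤ j ∧ 2 * τ + 3 ≤ j :=
    ⟨N + 2 * τ + 3, by omega, by omega⟩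
  have hjR : (1 : ℝ) ≤ j := by exact_mod_cast (by omega : 1 ≤ j)
  obtain ⟨m, hm⟩ : ∃ m : ℕ, m = 10 ^ (8 * j) := ⟨_, rfl⟩
  have hmpos : 0 < m := by rw [hm]; positivity
  have : NeZero m := ⟨hmpos.ne'⟩
  have hn : m * m = 10 ^ (16 * j) := by rw [hm, ← pow_add]; congr 1; ring
  have hnR : ((m * m : ℕ) : ℝ) = 10 ^ (16 * j) := by rw [hn]; push_cast; rfl
  have hlogn : Real.log (m * m : ℕ) = 16 * j * Real.log 10 := by
    rw [hnR, Real.log_pow]; push_cast; ring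
  have hjm : 8 * j < m := by rw [hm]; exact Nat.lt_pow_self (by norm_num)
  have hmm : m ≤ m * m := Nat.le_mul_of_pos_left m hmpos
  obtain ⟨g, hg⟩ := UniversalTSP.exists_hasGap m
  have hL : 0 < 8 * j := by omega
  obtain ⟨r⟩ : Nonempty (Fin (m * m)) := ⟨⟨0, Nat.mul_pos hmpos hmpos⟩⟩
  have : Nonempty (Fin (m * m)) := ⟨r⟩
  refine ⟨m * m, ⟨fun x y => (UniversalTSP.wordDist g (8 * j) x y : ℝ), r,
    UniversalTSP.isMetric_wordDist g hL, fun D => ?_⟩, by omega⟩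
  have h40 : 40 * j ≤ m * m :=
    (show 40 * j ≤ 8 * m by omega).trans (Nat.mul_le_mul_right m (by omega))
  have hK : 1 / (2 * Real.log 10 * (4 * τ + 24)) * Real.log (m * m : ℕ) *
      (4 * (τ * j : ℕ) + 3 * (8 * j : ℕ)) < (8 * j : ℕ) * (2 * j) := by
    rw [hlogn]
    push_cast
    have e : 1 / (2 * Real.log 10 * (4 * τ + 24)) * (16 * j * Real.log 10) *
        (4 * (τ * j) + 3 * (8 * j)) = 8 * (j * j : ℝ) := by
      field_simp
      ring
    rw [e]
    nlinarith
  obtain ⟨ω, hω⟩ := UniversalTSP.exists_pr_le D (Ω := (Fin (m * m) × (Fin (2 * (τ * j)) → Fin 5)) ×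
      (Fin (m * m) × (Fin (2 * (τ * j)) → Fin 5))) _ (1 / 2 * (1 / 2) ^ j) (fun σ =>
    (UniversalTSP.card_cheap_le hg hL r σ j (τ * j) (by omega) h40
      (1 / (2 * Real.log 10 * (4 * τ + 24)) * Real.log (m * m : ℕ))
      (by rw [hlogn]; positivity) hK).trans (by
        have hΩ : (Fintype.card ((Fin (m * m) × (Fin (2 * (τ * j)) → Fin 5)) ×
            (Fin (m * m) × (Fin (2 * (τ * j)) → Fin 5))) : ℝ) =
            (10 ^ (16 * j) * 25 ^ (τ * j)) * (10 ^ (16 * j) * 25 ^ (τ * j)) := by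
          rw [← hnR]
          simp [pow_mul]
        rw [hΩ, hnR]
        have h := UniversalTSP.cheap_bound_le hτ.le hjτ
        refine (mul_le_mul_of_nonneg_left h (by positivity)).trans (le_of_eq ?_)
        ring))
  have hX : (((UniversalTSP.trajectory g (2 * (τ * j)) ω.1.1 ω.1.2 ++
      UniversalTSP.trajectory g (2 * (τ * j)) ω.2.1 ω.2.2).toFinset.card : ℕ) : ℝ) ≤
      6 * τ * j := by
    have h1 := List.toFinset_card_le (UniversalTSP.trajectory g (2 * (τ * j)) ω.1.1 ω.1.2 ++
      UniversalTSP.trajectory g (2 * (τ * j)) ω.2.1 ω.2.2)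
    rw [List.length_append, UniversalTSP.length_trajectory,
      UniversalTSP.length_trajectory] at h1
    have h2 : 1 ≤ τ * j := Nat.mul_pos hτ0 (by omega)
    have h3 := h1.trans (show 2 * (τ * j) + 1 + (2 * (τ * j) + 1) ≤ 6 * (τ * j) by omega)
    rw [mul_assoc]
    exact_mod_cast h3
  refine ⟨_, hX.trans ?_, hω.trans ?_⟩
  · rw [hlogn]
    gcongr
    nlinarith
  · gcongr
    have e : (1 / 2 : ℝ) ^ j = Real.exp (-(Real.log 2 / (6 * τ)) * (6 * τ * j)) := by
      have : -(Real.log 2 / (6 * τ)) * (6 * τ * j) = j * -Real.log 2 := by field_simp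
      rw [this, Real.exp_nat_mul, Real.exp_neg, Real.exp_log (by norm_num), one_div]
    rw [e, Real.exp_le_exp]
    exact mul_le_mul_of_nonpos_left hX (by rw [neg_nonpos]; positivity)
end
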